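/- arXiv:2305.03285 — 3 statements merged into one kernel-verified Lean document; each statement's English description precedes it below -/
import Mathlib

section
/- Let C be the extended ternary quadratic residue code of length 14. For every integer ℓ with 2 ≤ ℓ ≤ 14 and ℓ ≠ 10 such that the shell C_ℓ is nonempty, there exists a natural number λ such that C_ℓ is a combinatorial 2-(14, ℓ, λ) design with repeated blocks, i.e. for every 2-element subset T of {1,…,14} the number of codewords c ∈ C_ℓ with T ⊆ supp(c) equals λ. -/
open scoped Classical

noncomputable section

/-- Membership in the ternary quadratic residue code of length 13: the codeword, viewed
as the polynomial `∑ cᵢ Xⁱ` modulo `X ^ 13 - 1`, lies in the ideal generated by the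
polynomial whose roots are `α ^ ℓ` for `ℓ` running over the nonzero squares mod 13;
equivalently (as that generator is separable and divides `X ^ 13 - 1`), the codeword
polynomial vanishes at `α ^ ℓ` for every nonzero square `ℓ` modulo 13. -/
def qr3Mem {K : Type} [Field K] [Algebra (ZMod 3) K] (α : K) (c : Fin 13 → ZMod 3) : Prop :=
  ∀ ℓ : ZMod 13, ℓ ≠ 0 → IsSquare ℓ →
    ∑ i : Fin 13, algebraMap (ZMod 3) K (c i) * α ^ (ℓ.val * (i : ℕ)) = 0

/-- Membership in the extended ternary quadratic residue code of length 14: the first 13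
coordinates form a codeword of the quadratic residue code of length 13 and the last
coordinate is minus the sum of the first 13. -/
def extQR3Mem {K : Type} [Field K] [Algebra (ZMod 3) K] (α : K) (c : Fin 14 → ZMod 3) : Prop :=
  qr3Mem α (fun i => c i.castSucc) ∧ c (Fin.last 13) = - ∑ i : Fin 13, c i.castSucc

/-- Hamming weight: the number of nonzero coordinates. -/
def wt {n : ℕ} {F : Type} [Zero F] (c : Fin n → F) : ℕ :=
  (Finset.univ.filter fun i => c i ≠ 0).card

/-- Support: the set of nonzero coordinate positions. -/
def supp {n : ℕ} {F : Type} [Zero F] (c : Fin n → F) : Finset (Fin n) :=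
  Finset.univ.filter fun i => c i ≠ 0

/-! ### Digit expansions -/

theorem sum_mul_pow_lt {n B : ℕ} (a : Fin n → ℕ) (ha : ∀ i, a i < B) :
    ∑ i, a i * B ^ (i : ℕ) < B ^ n := by
  induction n with
  | zero => simp
  | succ n ih =>
    have h := ih (fun i => a i.castSucc) fun i => ha _
    rw [Fin.sum_univ_castSucc, pow_succ']
    have h' : (a (Fin.last n) + 1) * B ^ n ≤ B * B ^ n := Nat.mul_le_mul_right _ (ha _)
    simp only [Fin.val_castSucc, Fin.val_last]
    linarith

theorem sum_mul_pow_succ {n : ℕ} (B : ℕ) (a : Fin (n + 1) → ℕ) :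
    ∑ i, a i * B ^ (i : ℕ) = a 0 + B * ∑ i : Fin n, a i.succ * B ^ (i : ℕ) := by
  rw [Fin.sum_univ_succ, Finset.mul_sum]
  simp [pow_succ, mul_comm, mul_left_comm]

theorem eq_of_sum_mul_pow_eq {n B : ℕ} {a b : Fin n → ℕ} (ha : ∀ i, a i < B)
    (hb : ∀ i, b i < B) (h : ∑ i, a i * B ^ (i : ℕ) = ∑ i, b i * B ^ (i : ℕ)) (i : Fin n) :
    a i = b i := by
  induction n with
  | zero => exact i.elim0
  | succ n ih =>
    rw [sum_mul_pow_succ, sum_mul_pow_succ] at h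
    have h0 : a 0 = b 0 := by
      have := congrArg (· % B) h
      simpa [Nat.mod_eq_of_lt (ha 0), Nat.mod_eq_of_lt (hb 0)] using this
    have hB : 0 < B := (Nat.zero_le _).trans_lt (ha 0)
    rw [h0, Nat.add_left_cancel_iff, Nat.mul_right_inj hB.ne'] at h
    refine Fin.cases h0 (fun i => ?_) i
    exact ih (fun i => ha _) (fun i => hb _) h i

/-! ### Counting in a ternary linear code with a single natural number -/

/-- Reads `n` base-32 digits of `w`, and evaluates at `b` the polynomial whose coefficients
indicate which of these digits are not divisible by 3. -/
def digitIndicatorEval (b : ℕ) : ℕ → ℕ → ℕ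
  | 0, _ => 0
  | n + 1, w => (w % 32 % 3 + 1) / 2 + b * digitIndicatorEval b n (w / 32)

/-- The contribution of the packed word `w` to the joint generating function of weights and pairs
of support positions. -/
def pairWeight (w : ℕ) : ℕ :=
  (4096 ^ 196) ^ digitIndicatorEval 1 14 w *
    (digitIndicatorEval 4096 14 w * digitIndicatorEval (4096 ^ 14) 14 w)

/-- The sum of `pairWeight` over the coset of `w` in the ternary span of a list of packed rows. -/
def pairWeightSum : List ℕ → ℕ → ℕ
  | [], w => pairWeight w
  | r :: rs, w => pairWeightSum rs w + pairWeightSum rs (w + r) + pairWeightSum rs (w + 2 * r)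

theorem digitIndicatorEval_sum (b n : ℕ) (d : Fin n → ℕ) (hd : ∀ i, d i < 32) :
    digitIndicatorEval b n (∑ i, d i * 32 ^ (i : ℕ)) =
      ∑ i, (d i % 3 + 1) / 2 * b ^ (i : ℕ) := by
  induction n with
  | zero => simp [digitIndicatorEval]
  | succ n ih =>
    have h0 := hd 0
    rw [digitIndicatorEval, sum_mul_pow_succ, Nat.add_mul_mod_self_left, Nat.mod_eq_of_lt h0,
      Nat.add_mul_div_left _ _ (by norm_num), Nat.div_eq_of_lt h0, zero_add,
      ih _ fun i => hd _, sum_mul_pow_succ b fun i => (d i % 3 + 1) / 2]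

theorem pairWeightSum_ofFn (n : ℕ) (R : Fin n → ℕ) (w : ℕ) :
    pairWeightSum (List.ofFn R) w =
      ∑ m : Fin n → ZMod 3, pairWeight (w + ∑ k, (m k).val * R k) := by
  induction n generalizing w with
  | zero => simp [pairWeightSum]
  | succ n ih =>
    have sum_three (f : ZMod 3 → ℕ) : ∑ x, f x = f 0 + f 1 + f 2 := Fin.sum_univ_three f
    rw [List.ofFn_succ, pairWeightSum, ih, ih, ih,
      ← (Fin.consEquiv fun _ : Fin (n + 1) => ZMod 3).sum_comp, Fintype.sum_prod_type, sum_three]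
    have h2 : (2 : ZMod 3).val = 2 := rfl
    have h1 : (1 : ZMod 3).val = 1 := rfl
    simp [Fin.consEquiv, Fin.sum_univ_succ, add_assoc, h1, h2]

/-- The ternary word encoding the message `m` by the generator matrix `M`. -/
def encode (M : Matrix (Fin 7) (Fin 14) ℕ) (m : Fin 7 → ZMod 3) (i : Fin 14) : ZMod 3 :=
  ∑ k, m k * (M k i : ZMod 3)

/-- The indicator of the support of a ternary word. -/
def suppInd (c : Fin 14 → ZMod 3) (i : Fin 14) : ℕ := if c i = 0 then 0 else 1

/-- The number of messages whose codeword has weight `ℓ` and support containing `i` and `j`. -/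
def pairCount (M : Matrix (Fin 7) (Fin 14) ℕ) (ℓ : ℕ) (i j : Fin 14) : ℕ :=
  ∑ m, if wt (encode M m) = ℓ then suppInd (encode M m) i * suppInd (encode M m) j else 0

theorem wt_eq_sum_suppInd (c : Fin 14 → ZMod 3) : wt c = ∑ i, suppInd c i := by
  simp [wt, suppInd, Finset.card_filter]

theorem wt_lt (c : Fin 14 → ZMod 3) : wt c < 15 :=
  Nat.lt_succ_of_le ((Finset.card_le_univ _).trans (by simp))

theorem suppInd_le_one (c : Fin 14 → ZMod 3) (i : Fin 14) : suppInd c i ≤ 1 := by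
  unfold suppInd; split_ifs <;> simp

theorem pairCount_lt (M : Matrix (Fin 7) (Fin 14) ℕ) (ℓ : ℕ) (i j : Fin 14) :
    pairCount M ℓ i j < 4096 := by
  have h : pairCount M ℓ i j ≤ ∑ _m : Fin 7 → ZMod 3, 1 := by
    refine Finset.sum_le_sum fun m _ => ?_
    split_ifs
    · exact Nat.mul_le_mul (suppInd_le_one _ _) (suppInd_le_one _ _)
    · simp
  refine h.trans_lt ?_
  simp [ZMod.card]

theorem pairWeight_encode (M : Matrix (Fin 7) (Fin 14) ℕ) (hM : ∀ k i, M k i < 3)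
    (m : Fin 7 → ZMod 3) :
    pairWeight (0 + ∑ k, (m k).val * ∑ i, M k i * 32 ^ (i : ℕ)) =
      (4096 ^ 196) ^ wt (encode M m) *
        ((∑ i, suppInd (encode M m) i * 4096 ^ (i : ℕ)) *
          ∑ j, suppInd (encode M m) j * (4096 ^ 14) ^ (j : ℕ)) := by
  have hw : 0 + ∑ k, (m k).val * ∑ i, M k i * 32 ^ (i : ℕ) =
      ∑ i, (∑ k, (m k).val * M k i) * 32 ^ (i : ℕ) := by
    simp only [zero_add, Finset.mul_sum, Finset.sum_mul, mul_assoc]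
    exact Finset.sum_comm
  have hd (i : Fin 14) : ∑ k, (m k).val * M k i < 32 := by
    have : ∑ k, (m k).val * M k i ≤ ∑ _k : Fin 7, 2 * 2 :=
      Finset.sum_le_sum fun k _ =>
        Nat.mul_le_mul (Nat.le_of_lt_succ (ZMod.val_lt (m k))) (Nat.le_of_lt_succ (hM k i))
    refine this.trans_lt ?_
    simp
  have hind (i : Fin 14) :
      ((∑ k, (m k).val * M k i) % 3 + 1) / 2 = suppInd (encode M m) i := by
    have hc : encode M m i = ((∑ k, (m k).val * M k i : ℕ) : ZMod 3) := by
      simp [encode]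
    simp only [suppInd, hc, ZMod.natCast_eq_zero_iff]
    split_ifs <;> omega
  rw [pairWeight, hw]
  simp only [digitIndicatorEval_sum _ _ _ hd, hind, one_pow, mul_one, ← wt_eq_sum_suppInd]

theorem pairWeightSum_eq_sum_pairCount (M : Matrix (Fin 7) (Fin 14) ℕ) (hM : ∀ k i, M k i < 3) :
    pairWeightSum (List.ofFn fun k => ∑ i, M k i * 32 ^ (i : ℕ)) 0 =
      ∑ ℓ : Fin 15, (∑ j : Fin 14, (∑ i : Fin 14, pairCount M ℓ i j * 4096 ^ (i : ℕ)) *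
        (4096 ^ 14) ^ (j : ℕ)) * (4096 ^ 196) ^ (ℓ : ℕ) := by
  rw [pairWeightSum_ofFn]
  simp only [pairWeight_encode M hM, pairCount]
  generalize 4096 ^ 196 = X
  generalize 4096 ^ 14 = Y
  generalize 4096 = Z
  have hX (m : Fin 7 → ZMod 3) (a : ℕ) : X ^ wt (encode M m) * a =
      ∑ ℓ : Fin 15, (if wt (encode M m) = ℓ then X ^ (ℓ : ℕ) else 0) * a := by
    rw [Finset.sum_eq_single ⟨wt (encode M m), wt_lt _⟩]
    · simp
    · intro b _ hb
      rw [if_neg, zero_mul]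
      intro h
      exact hb (Fin.ext h.symm)
    · simp
  simp only [hX]
  rw [Finset.sum_comm]
  refine Finset.sum_congr rfl fun ℓ _ => ?_
  have hm (m : Fin 7 → ZMod 3) :
      (if wt (encode M m) = ℓ then X ^ (ℓ : ℕ) else 0) *
        ((∑ i, suppInd (encode M m) i * Z ^ (i : ℕ)) *
          ∑ j, suppInd (encode M m) j * Y ^ (j : ℕ)) =
      ∑ j : Fin 14, ∑ i : Fin 14,
        (if wt (encode M m) = ℓ then suppInd (encode M m) i * suppInd (encode M m) j else 0) *
          Z ^ (i : ℕ) * Y ^ (j : ℕ) * X ^ (ℓ : ℕ) := by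
    split_ifs
    · rw [mul_comm (∑ i, _), Finset.sum_mul_sum, Finset.mul_sum]
      refine Finset.sum_congr rfl fun j _ => ?_
      rw [Finset.mul_sum]
      refine Finset.sum_congr rfl fun i _ => ?_
      ring
    · simp
  rw [Finset.sum_congr rfl fun m _ => hm m]
  simp only [Finset.sum_mul]
  rw [Finset.sum_comm]
  exact Finset.sum_congr rfl fun j _ => Finset.sum_comm

/-- The number of codewords of each weight whose support contains two given positions. -/
def pairMult (ℓ : ℕ) : ℕ :=
  [0, 0, 0, 0, 0, 0, 30, 36, 112, 144, 270, 220, 132, 0, 28].getD ℓ 0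

/-- The number of codewords of each weight whose support contains a given position. -/
def pointMult (ℓ : ℕ) : ℕ :=
  [0, 0, 0, 0, 0, 0, 78, 78, 208, 234, 390, 286, 156, 0, 28].getD ℓ 0

/-- The value of `pairWeightSum` for a code all of whose shells are designs with the
multiplicities `pairMult` and `pointMult`. -/
def designSum : ℕ :=
  ∑ ℓ : Fin 15, (∑ j : Fin 14, (∑ i : Fin 14,
    (if i = j then pointMult ℓ else pairMult ℓ) * 4096 ^ (i : ℕ)) *
      (4096 ^ 14) ^ (j : ℕ)) * (4096 ^ 196) ^ (ℓ : ℕ)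

theorem pairCount_eq (M : Matrix (Fin 7) (Fin 14) ℕ) (hM : ∀ k i, M k i < 3)
    (h : pairWeightSum (List.ofFn fun k => ∑ i, M k i * 32 ^ (i : ℕ)) 0 = designSum)
    (ℓ : Fin 15) {i j : Fin 14} (hij : i ≠ j) : pairCount M ℓ i j = pairMult ℓ := by
  rw [pairWeightSum_eq_sum_pairCount M hM, designSum] at h
  have hD (ℓ : Fin 15) (i j : Fin 14) : (if i = j then pointMult ℓ else pairMult ℓ) < 4096 := by
    split_ifs
    · revert ℓ; decide
    · revert ℓ; decide
  have hpow (n : ℕ) : (4096 ^ 14) ^ n = 4096 ^ (14 * n) := (pow_mul _ _ _).symm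
  have h196 : 4096 ^ 196 = (4096 ^ 14) ^ 14 := (hpow 14).symm
  have hinner (a : Fin 14 → Fin 14 → ℕ) (ha : ∀ i j, a i j < 4096) (j : Fin 14) :
      ∑ i, a i j * 4096 ^ (i : ℕ) < 4096 ^ 14 := sum_mul_pow_lt _ fun i => ha i j
  have houter (a : Fin 14 → Fin 14 → ℕ) (ha : ∀ i j, a i j < 4096) :
      ∑ j, (∑ i, a i j * 4096 ^ (i : ℕ)) * (4096 ^ 14) ^ (j : ℕ) < 4096 ^ 196 := by
    rw [h196]
    exact sum_mul_pow_lt _ (hinner a ha)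
  have e1 := eq_of_sum_mul_pow_eq (fun ℓ => houter _ (pairCount_lt M ℓ))
    (fun ℓ => houter _ (hD ℓ)) h ℓ
  have e2 := eq_of_sum_mul_pow_eq (hinner _ (pairCount_lt M ℓ)) (hinner _ (hD ℓ)) e1 j
  have e3 := eq_of_sum_mul_pow_eq (fun i => pairCount_lt M ℓ i j) (fun i => hD ℓ i j) e2 i
  rwa [if_neg hij] at e3

theorem ncard_eq_pairCount (M : Matrix (Fin 7) (Fin 14) ℕ)
    (hsys : ∀ k j : Fin 7, M k (j.castLE (by norm_num)) = if k = j then 1 else 0)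
    (ℓ : ℕ) (i j : Fin 14) :
    {c | (∃ m, c = encode M m) ∧ wt c = ℓ ∧ {i, j} ⊆ supp c}.ncard = pairCount M ℓ i j := by
  have hinj : Function.Injective (encode M) := by
    intro m m' h
    funext j
    have hj (m : Fin 7 → ZMod 3) : encode M m (j.castLE (by norm_num)) = m j := by
      simp only [encode, hsys]
      simp
    rw [← hj m, h, hj]
  have himage : {c | (∃ m, c = encode M m) ∧ wt c = ℓ ∧ {i, j} ⊆ supp c} =
      encode M '' (Finset.univ.filter fun m =>
        wt (encode M m) = ℓ ∧ {i, j} ⊆ supp (encode M m) : Finset (Fin 7 → ZMod 3)) := by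
    ext c
    simp only [Set.mem_ofPred_eq, Set.mem_image, Finset.coe_filter, Finset.mem_univ, true_and]
    constructor
    · rintro ⟨⟨m, rfl⟩, h⟩
      exact ⟨m, h, rfl⟩
    · rintro ⟨m, h, rfl⟩
      exact ⟨⟨m, rfl⟩, h⟩
  rw [himage, Set.ncard_image_of_injective _ hinj, Set.ncard_coe_finset, Finset.card_filter,
    pairCount]
  refine Finset.sum_congr rfl fun m _ => ?_
  by_cases hw : wt (encode M m) = ℓ <;>
  by_cases hi : encode M m i = 0 <;>
  by_cases hj : encode M m j = 0 <;>
  simp [hw, hi, hj, suppInd, supp, Finset.insert_subset_iff]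

/-! ### Systematic encoding of the extended quadratic residue codes -/

theorem eq_zero_of_qr3Mem {K : Type} [Field K] [Algebra (ZMod 3) K] {α : K}
    (hα : IsPrimitiveRoot α 13) {c : Fin 13 → ZMod 3} (hc : qr3Mem α c)
    (h0 : ∀ k : Fin 7, c (k.castLE (by norm_num)) = 0) : c = 0 := by
  let q : Fin 6 → ZMod 13 := ![1, 3, 4, 9, 10, 12]
  have hq : ∀ a, q a ≠ 0 ∧ IsSquare (q a) := by decide
  have hqinj : Function.Injective q := by decide
  have hnodes : Function.Injective fun a => α ^ (q a).val := fun a b hab =>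
    hqinj (ZMod.val_injective 13 (hα.pow_inj (ZMod.val_lt _) (ZMod.val_lt _) hab))
  have hv := Matrix.eq_zero_of_forall_index_sum_mul_pow_eq_zero
    (v := fun i : Fin 6 => algebraMap (ZMod 3) K (c (Fin.natAdd 7 i))) hnodes fun a => by
      have h := hc (q a) (hq a).1 (hq a).2
      replace h := (Fin.sum_univ_add (a := 7) (b := 6) _).symm.trans h
      have hzero (k : Fin 7) : c (Fin.castAdd 6 k) = 0 := h0 k
      have hα0 : α ^ ((q a).val * 7) ≠ 0 := pow_ne_zero _ (hα.ne_zero (by norm_num))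
      refine (mul_eq_zero.mp ?_).resolve_left hα0
      rw [← h, Finset.mul_sum]
      simp only [hzero, map_zero, zero_mul, Finset.sum_const_zero, zero_add]
      refine Finset.sum_congr rfl fun i _ => ?_
      simp only [Fin.val_natAdd]
      ring
  funext i
  refine Fin.addCases (m := 7) (n := 6) h0 (fun i => ?_) i
  exact (map_eq_zero _).mp (congrFun hv i)

theorem extQR3Mem_encode {K : Type} [Field K] [Algebra (ZMod 3) K] {α : K}
    (M : Matrix (Fin 7) (Fin 14) ℕ)
    (hext : ∀ k, (M k (Fin.last 13) : ZMod 3) = -∑ i : Fin 13, (M k i.castSucc : ZMod 3))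
    (hroot : ∀ ℓ : ZMod 13, ℓ ≠ 0 → IsSquare ℓ → ∀ k,
      ∑ i : Fin 13, (M k i.castSucc : K) * (α ^ ℓ.val) ^ (i : ℕ) = 0) (m : Fin 7 → ZMod 3) :
    extQR3Mem α (encode M m) := by
  constructor
  · intro ℓ hℓ hsq
    simp only [encode, map_sum, map_mul, map_natCast, Finset.sum_mul, pow_mul]
    rw [Finset.sum_comm]
    refine Finset.sum_eq_zero fun k _ => ?_
    simp only [mul_assoc, ← Finset.mul_sum, hroot ℓ hℓ hsq k, mul_zero]
  · simp only [encode, hext]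
    rw [Finset.sum_comm, ← Finset.sum_neg_distrib]
    simp only [mul_neg, Finset.mul_sum]

theorem extQR3Mem_iff {K : Type} [Field K] [Algebra (ZMod 3) K] {α : K}
    (hα : IsPrimitiveRoot α 13) (M : Matrix (Fin 7) (Fin 14) ℕ)
    (hsys : ∀ k j : Fin 7, M k (j.castLE (by norm_num)) = if k = j then 1 else 0)
    (hext : ∀ k, (M k (Fin.last 13) : ZMod 3) = -∑ i : Fin 13, (M k i.castSucc : ZMod 3))
    (hroot : ∀ ℓ : ZMod 13, ℓ ≠ 0 → IsSquare ℓ → ∀ k,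
      ∑ i : Fin 13, (M k i.castSucc : K) * (α ^ ℓ.val) ^ (i : ℕ) = 0) (c : Fin 14 → ZMod 3) :
    extQR3Mem α c ↔ ∃ m, c = encode M m := by
  constructor
  · intro hc
    let m : Fin 7 → ZMod 3 := fun k => c (k.castLE (by norm_num))
    have he := extQR3Mem_encode M hext hroot m
    have hdiff : (fun i : Fin 13 => c i.castSucc - encode M m i.castSucc) = 0 := by
      refine eq_zero_of_qr3Mem hα (fun ℓ hℓ hsq => ?_) fun k => ?_
      · simp only [map_sub, sub_mul, Finset.sum_sub_distrib]
        rw [hc.1 ℓ hℓ hsq, he.1 ℓ hℓ hsq, sub_zero]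
      · have : encode M m (k.castLE (by norm_num)) = m k := by simp [encode, hsys]
        exact sub_eq_zero.mpr this.symm
    have hcs (i : Fin 13) : c i.castSucc = encode M m i.castSucc :=
      sub_eq_zero.mp (congrFun hdiff i)
    refine ⟨m, funext fun i => Fin.lastCases ?_ hcs i⟩
    rw [hc.2, he.2]
    simp only [hcs]
  · rintro ⟨m, rfl⟩
    exact extQR3Mem_encode M hext hroot m

theorem two_design_of_generator {K : Type} [Field K] [Algebra (ZMod 3) K] {α : K}
    (hα : IsPrimitiveRoot α 13) (M : Matrix (Fin 7) (Fin 14) ℕ) (hM : ∀ k i, M k i < 3)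
    (hsys : ∀ k j : Fin 7, M k (j.castLE (by norm_num)) = if k = j then 1 else 0)
    (hext : ∀ k, (M k (Fin.last 13) : ZMod 3) = -∑ i : Fin 13, (M k i.castSucc : ZMod 3))
    (hroot : ∀ ℓ : ZMod 13, ℓ ≠ 0 → IsSquare ℓ → ∀ k,
      ∑ i : Fin 13, (M k i.castSucc : K) * (α ^ ℓ.val) ^ (i : ℕ) = 0)
    (hsum : pairWeightSum (List.ofFn fun k => ∑ i, M k i * 32 ^ (i : ℕ)) 0 = designSum)
    {ℓ : ℕ} (hℓ : ℓ ≤ 14) {T : Finset (Fin 14)} (hT : T.card = 2) :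
    {c : Fin 14 → ZMod 3 | extQR3Mem α c ∧ wt c = ℓ ∧ T ⊆ supp c}.ncard = pairMult ℓ := by
  obtain ⟨i, j, hij, rfl⟩ := Finset.card_eq_two.mp hT
  simp only [extQR3Mem_iff hα M hsys hext hroot]
  rw [ncard_eq_pairCount M hsys]
  exact pairCount_eq M hM hsum ⟨ℓ, Nat.lt_succ_of_le hℓ⟩ hij

/-- If a property passes from `x` to `x ^ 4` then, as 4 generates the squares modulo 13, it passes
from a 13th root of unity to all its powers with exponent a nonzero square. -/
theorem pow_square_induction {K : Type} [Field K] {α : K} (hα : α ^ 13 = 1) (p : K → Prop)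
    (hp : ∀ x, p x → p (x ^ 4)) (h : p α) (ℓ : ZMod 13) (hℓ : ℓ ≠ 0) (hsq : IsSquare ℓ) :
    p (α ^ ℓ.val) := by
  have hiter (n : ℕ) : p (α ^ 4 ^ n) := by
    induction n with
    | zero => simpa using h
    | succ n ih => rw [pow_succ, pow_mul]; exact hp _ ih
  have hgen : ∀ ℓ : ZMod 13, ℓ ≠ 0 → IsSquare ℓ → ∃ n : Fin 6, 4 ^ (n : ℕ) % 13 = ℓ.val := by
    decide
  obtain ⟨n, hn⟩ := hgen ℓ hℓ hsq
  rw [← hn, ← pow_eq_pow_mod _ hα]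
  exact hiter n

theorem qr_root_pow_four {K : Type} [Field K] (h3 : (3 : K) = 0) {x : K}
    (h : 1 + x - x ^ 2 - x ^ 4 + x ^ 5 + x ^ 6 = 0) :
    1 + (x ^ 4) - (x ^ 4) ^ 2 - (x ^ 4) ^ 4 + (x ^ 4) ^ 5 + (x ^ 4) ^ 6 = 0 := by
  linear_combination (1 - x - x ^ 2 + x ^ 4 - x ^ 7 - x ^ 8
      - x ^ 9 - x ^ 10 - x ^ 11 + x ^ 14 - x ^ 16 - x ^ 17 + x ^ 18) * h +
    (x ^ 2 - x ^ 5 + x ^ 7 + x ^ 8 + x ^ 16 + x ^ 17 - x ^ 19 + x ^ 22) * h3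

/-- Systematic generator matrix of the extension of the cyclic code generated by
`1 + X - X ^ 2 - X ^ 4 + X ^ 5 + X ^ 6`. -/
def qrGen : Matrix (Fin 7) (Fin 14) ℕ :=
  !![1, 0, 0, 0, 0, 0, 0, 1, 1, 2, 0, 2, 1, 1;
    0, 1, 0, 0, 0, 0, 0, 2, 0, 2, 2, 1, 1, 0;
    0, 0, 1, 0, 0, 0, 0, 2, 1, 1, 2, 0, 0, 2;
    0, 0, 0, 1, 0, 0, 0, 0, 2, 1, 1, 2, 0, 2;
    0, 0, 0, 0, 1, 0, 0, 0, 0, 2, 1, 1, 2, 2;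
    0, 0, 0, 0, 0, 1, 0, 1, 1, 2, 2, 0, 2, 0;
    0, 0, 0, 0, 0, 0, 1, 1, 2, 0, 2, 1, 1, 1]

theorem qrGen_eval_eq_zero {K : Type} [Field K] (h3 : (3 : K) = 0) {x : K}
    (h : 1 + x - x ^ 2 - x ^ 4 + x ^ 5 + x ^ 6 = 0) (k : Fin 7) :
    ∑ i : Fin 13, (qrGen k i.castSucc : K) * x ^ (i : ℕ) = 0 := by
  fin_cases k <;> simp [qrGen, Fin.sum_univ_succ]
  · linear_combination (1 - x - x ^ 2 + x ^ 5 + x ^ 6) * h +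
      (x ^ 2 - x ^ 5 - x ^ 6 + x ^ 7 + x ^ 8 + x ^ 9) * h3
  · linear_combination (x - x ^ 2 - x ^ 3 + x ^ 6) * h +
      (x ^ 3 - x ^ 6 + x ^ 8 + x ^ 9 + x ^ 10) * h3
  · linear_combination (x ^ 2 - x ^ 3 - x ^ 4) * h + (x ^ 4 + x ^ 9 + x ^ 10) * h3
  · linear_combination (x ^ 3 - x ^ 4 - x ^ 5) * h + (x ^ 5 + x ^ 10 + x ^ 11) * h3
  · linear_combination (x ^ 4 - x ^ 5 - x ^ 6) * h + (x ^ 6 + x ^ 11 + x ^ 12) * h3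
  · linear_combination (x ^ 5 - x ^ 6) * h + (x ^ 7 + x ^ 9 + x ^ 12) * h3
  · linear_combination (x ^ 6) * h + (x ^ 8 + x ^ 10) * h3

theorem nr_root_pow_four {K : Type} [Field K] (h3 : (3 : K) = 0) {x : K}
    (h : 1 - x ^ 2 - x ^ 3 - x ^ 4 + x ^ 6 = 0) :
    1 - (x ^ 4) ^ 2 - (x ^ 4) ^ 3 - (x ^ 4) ^ 4 + (x ^ 4) ^ 6 = 0 := by
  linear_combination (1 + x ^ 2 + x ^ 3 - x ^ 4 - x ^ 5 - x ^ 7 - x ^ 8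
      - x ^ 10 - x ^ 11 - x ^ 13 - x ^ 14 + x ^ 15 + x ^ 16 + x ^ 18) * h +
    (x ^ 4 + x ^ 5 - x ^ 8 - x ^ 9 - x ^ 12 - x ^ 15 - x ^ 16 + x ^ 19 + x ^ 20) * h3

/-- Systematic generator matrix of the extension of the cyclic code generated by
`1 - X ^ 2 - X ^ 3 - X ^ 4 + X ^ 6`. -/
def nrGen : Matrix (Fin 7) (Fin 14) ℕ :=
  !![1, 0, 0, 0, 0, 0, 0, 1, 0, 2, 2, 2, 0, 1;
    0, 1, 0, 0, 0, 0, 0, 0, 1, 0, 2, 2, 2, 1;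
    0, 0, 1, 0, 0, 0, 0, 1, 0, 0, 2, 1, 2, 2;
    0, 0, 0, 1, 0, 0, 0, 1, 1, 2, 2, 1, 1, 0;
    0, 0, 0, 0, 1, 0, 0, 2, 1, 2, 0, 0, 1, 2;
    0, 0, 0, 0, 0, 1, 0, 2, 2, 2, 0, 1, 0, 1;
    0, 0, 0, 0, 0, 0, 1, 0, 2, 2, 2, 0, 1, 1]

theorem nrGen_eval_eq_zero {K : Type} [Field K] (h3 : (3 : K) = 0) {x : K}
    (h : 1 - x ^ 2 - x ^ 3 - x ^ 4 + x ^ 6 = 0) (k : Fin 7) :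
    ∑ i : Fin 13, (nrGen k i.castSucc : K) * x ^ (i : ℕ) = 0 := by
  fin_cases k <;> simp [nrGen, Fin.sum_univ_succ]
  · linear_combination (1 + x ^ 2 + x ^ 3 - x ^ 4 - x ^ 5) * h +
      (x ^ 4 + x ^ 5 - x ^ 8 + x ^ 10 + x ^ 11) * h3
  · linear_combination (x + x ^ 3 + x ^ 4 - x ^ 5 - x ^ 6) * h +
      (x ^ 5 + x ^ 6 - x ^ 9 + x ^ 11 + x ^ 12) * h3
  · linear_combination (x ^ 2 + x ^ 4 + x ^ 5 - x ^ 6) * h + (x ^ 6 + x ^ 7 + x ^ 12) * h3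
  · linear_combination (x ^ 3 + x ^ 5 + x ^ 6) * h + (x ^ 7 + x ^ 8 + x ^ 9 + x ^ 10) * h3
  · linear_combination (x ^ 4 + x ^ 6) * h + (x ^ 7 + x ^ 8 + x ^ 9) * h3
  · linear_combination (x ^ 5) * h + (x ^ 7 + x ^ 8 + x ^ 9) * h3
  · linear_combination (x ^ 6) * h + (x ^ 8 + x ^ 9 + x ^ 10) * h3

theorem pairWeightSum_qrGen :
    pairWeightSum (List.ofFn fun k => ∑ i, qrGen k i * 32 ^ (i : ℕ)) 0 = designSum := by
  decide +kernel

theorem pairWeightSum_nrGen :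
    pairWeightSum (List.ofFn fun k => ∑ i, nrGen k i * 32 ^ (i : ℕ)) 0 = designSum := by
  decide +kernel

/-- For the extended ternary quadratic residue code `C` of length 14 (defined via any fixed
primitive 13th root of unity `α` in an extension of `𝔽₃`), every nonempty shell `C_ℓ` with
`2 ≤ ℓ ≤ 14` and `ℓ ≠ 10` is a combinatorial `2`-`(14, ℓ, λ)` design (with repeated blocks):
there is `λ` such that every 2-element subset `T` of the coordinates is contained in the
support of exactly `λ` codewords of weight `ℓ`. -/
theorem ternary_shells_two_design (K : Type) [Field K] [Algebra (ZMod 3) K] (α : K)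
    (hα : IsPrimitiveRoot α 13) (ℓ : ℕ) (h2 : 2 ≤ ℓ) (h14 : ℓ ≤ 14) (h10 : ℓ ≠ 10)
    (hne : ∃ c : Fin 14 → ZMod 3, extQR3Mem α c ∧ wt c = ℓ) :
    ∃ lam : ℕ, ∀ T : Finset (Fin 14), T.card = 2 →
      {c : Fin 14 → ZMod 3 | extQR3Mem α c ∧ wt c = ℓ ∧ T ⊆ supp c}.ncard = lam := by
  have h3 : (3 : K) = 0 := by
    have h : ((3 : ℕ) : ZMod 3) = 0 := ZMod.natCast_self 3
    exact_mod_cast (map_natCast (algebraMap (ZMod 3) K) 3).symm.trans (by rw [h, map_zero])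
  have hsum := hα.geom_sum_eq_zero (by norm_num)
  simp only [Finset.sum_range_succ, Finset.sum_range_zero] at hsum
  have hfactor : (1 + α - α ^ 2 - α ^ 4 + α ^ 5 + α ^ 6) *
      (1 - α ^ 2 - α ^ 3 - α ^ 4 + α ^ 6) = 0 := by
    linear_combination hsum + (-α ^ 2 - α ^ 3 - α ^ 4 + α ^ 6 - α ^ 8 - α ^ 9 - α ^ 10) * h3
  refine ⟨pairMult ℓ, fun T hT => ?_⟩
  rcases mul_eq_zero.mp hfactor with h | h
  · refine two_design_of_generator hα qrGen (fun k => by fin_cases k <;> decide)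
      (by decide) (by decide) ?_
      pairWeightSum_qrGen h14 hT
    exact fun s hs hsq => qrGen_eval_eq_zero h3 (pow_square_induction hα.pow_eq_one
      (fun x => 1 + x - x ^ 2 - x ^ 4 + x ^ 5 + x ^ 6 = 0)
      (fun x => qr_root_pow_four h3) h s hs hsq)
  · refine two_design_of_generator hα nrGen (fun k => by fin_cases k <;> decide)
      (by decide) (by decide) ?_
      pairWeightSum_nrGen h14 hT
    exact fun s hs hsq => nrGen_eval_eq_zero h3 (pow_square_induction hα.pow_eq_one
      (fun x => 1 - x ^ 2 - x ^ 3 - x ^ 4 + x ^ 6 = 0)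
      (fun x => nr_root_pow_four h3) h s hs hsq)
end
end

section
/- Let C be the extended quaternary quadratic residue code of length 18. For every integer ℓ with 2 ≤ ℓ ≤ 18 and ℓ ≠ 13 such that the shell C_ℓ is nonempty, there exists a natural number λ such that C_ℓ is a combinatorial 2-(18, ℓ, λ) design with repeated blocks, i.e. for every 2-element subset T of {1,…,18} the number of codewords c ∈ C_ℓ with T ⊆ supp(c) equals λ. -/
open scoped Classical

noncomputable section

/-- The field with four elements. -/
abbrev F4 := GaloisField 2 2

/-- Membership in the quaternary quadratic residue code of length 17: the codeword, viewed
as the polynomial `∑ cᵢ Xⁱ` modulo `X ^ 17 - 1`, lies in the ideal generated by the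
polynomial whose roots are `α ^ ℓ` for `ℓ` running over the nonzero squares mod 17;
equivalently (as that generator is separable and divides `X ^ 17 - 1`), the codeword
polynomial vanishes at `α ^ ℓ` for every nonzero square `ℓ` modulo 17. -/
def qr4Mem {K : Type} [Field K] [Algebra F4 K] (α : K) (c : Fin 17 → F4) : Prop :=
  ∀ ℓ : ZMod 17, ℓ ≠ 0 → IsSquare ℓ →
    ∑ i : Fin 17, algebraMap F4 K (c i) * α ^ (ℓ.val * (i : ℕ)) = 0

/-- Membership in the extended quaternary quadratic residue code of length 18: the first 17
coordinates form a codeword of the quadratic residue code of length 17 and the last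
coordinate is minus the sum of the first 17. -/
def extQR4Mem {K : Type} [Field K] [Algebra F4 K] (α : K) (c : Fin 18 → F4) : Prop :=
  qr4Mem α (fun i => c i.castSucc) ∧ c (Fin.last 17) = - ∑ i : Fin 17, c i.castSucc

/-! ### Permutations of the eighteen coordinates

The position `17` plays the role of the point at infinity of the projective line over
`ZMod 17`. -/

/-- The permutation `z ↦ z + 1` of the projective line over `ZMod 17`. -/
def shiftPerm : Equiv.Perm (Fin 18) where
  toFun z := if z = 17 then 17 else Fin.ofNat 18 ((z.val + 1) % 17)
  invFun z := if z = 17 then 17 else Fin.ofNat 18 ((z.val + 16) % 17)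
  left_inv := by decide
  right_inv := by decide

/-- The permutation `z ↦ -1 / z` of the projective line over `ZMod 17`. -/
def negInvPerm : Equiv.Perm (Fin 18) :=
  Function.Involutive.toPerm
    (fun z => if z = 17 then 0 else if z = 0 then 17 else Fin.ofNat 18 (16 * z.val ^ 15 % 17))
    (by unfold Function.Involutive; decide)

theorem exists_shiftPerm_pow_eq_zero : ∀ z : Fin 18, z ≠ 17 → ∃ a : Fin 17,
    (shiftPerm ^ (a : ℕ)) z = 0 := by
  have h : ∀ z : Fin 18, z ≠ 17 →
      (shiftPerm ^ ((Fin.ofNat 17 (17 - z.val) : Fin 17) : ℕ)) z = 0 := by decide +kernel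
  exact fun z hz => ⟨_, h z hz⟩

theorem shiftPerm_pow_last (a : ℕ) : (shiftPerm ^ a) 17 = 17 := by
  have h : shiftPerm 17 = 17 := by decide
  rw [Equiv.Perm.coe_pow]
  exact Function.iterate_fixed h a

theorem exists_mem_closure_map_pair {x y : Fin 18} (hxy : x ≠ y) :
    ∃ g ∈ Subgroup.closure {shiftPerm, negInvPerm}, g x = 17 ∧ g y = 0 := by
  have hs : shiftPerm ∈ Subgroup.closure {shiftPerm, negInvPerm} :=
    Subgroup.subset_closure (by simp)
  have hn : negInvPerm ∈ Subgroup.closure {shiftPerm, negInvPerm} :=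
    Subgroup.subset_closure (by simp)
  have key : ∀ y : Fin 18, 17 ≠ y →
      ∃ g ∈ Subgroup.closure {shiftPerm, negInvPerm}, g 17 = 17 ∧ g y = 0 := fun y hy => by
    obtain ⟨a, ha⟩ := exists_shiftPerm_pow_eq_zero y hy.symm
    exact ⟨_, pow_mem hs a, shiftPerm_pow_last a, ha⟩
  by_cases hx : x = 17
  · subst hx
    exact key y hxy
  · obtain ⟨a, ha⟩ := exists_shiftPerm_pow_eq_zero x hx
    have h17 : (negInvPerm * shiftPerm ^ (a : ℕ)) x = 17 := by
      rw [Equiv.Perm.mul_apply, ha]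
      decide
    obtain ⟨g, hg, hg1, hg2⟩ := key ((negInvPerm * shiftPerm ^ (a : ℕ)) y) fun h =>
      hxy ((negInvPerm * shiftPerm ^ (a : ℕ)).injective (h17.trans h))
    refine ⟨g * (negInvPerm * shiftPerm ^ (a : ℕ)), mul_mem hg (mul_mem hn (pow_mem hs a)), ?_, ?_⟩
    · rw [Equiv.Perm.mul_apply, h17, hg1]
    · rw [Equiv.Perm.mul_apply, hg2]

theorem exists_mem_closure_map_eq {T U : Finset (Fin 18)} (hT : T.card = 2) (hU : U.card = 2) :
    ∃ g ∈ Subgroup.closure {shiftPerm, negInvPerm}, T.map g.toEmbedding = U := by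
  obtain ⟨x, y, hxy, rfl⟩ := Finset.card_eq_two.mp hT
  obtain ⟨u, v, huv, rfl⟩ := Finset.card_eq_two.mp hU
  obtain ⟨g, hg, hx, hy⟩ := exists_mem_closure_map_pair hxy
  obtain ⟨k, hk, hu, hv⟩ := exists_mem_closure_map_pair huv
  refine ⟨k⁻¹ * g, mul_mem (inv_mem hk) hg, ?_⟩
  simp [Finset.map_insert, hx, hy, ← hu, ← hv]

/-! ### Permutation automorphisms of a set of words -/

/-- The permutations of the coordinates that map a set of words into itself. -/
def permAut {n : ℕ} {F : Type} (C : Set (Fin n → F)) : Submonoid (Equiv.Perm (Fin n)) where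
  carrier := {g | ∀ c ∈ C, c ∘ g ∈ C}
  one_mem' _ hc := hc
  mul_mem' ha hb c hc := hb _ (ha c hc)

theorem closure_le_permAut {n : ℕ} {F : Type} {C : Set (Fin n → F)}
    {s : Set (Equiv.Perm (Fin n))} (hs : s ⊆ permAut C) {g : Equiv.Perm (Fin n)}
    (hg : g ∈ Subgroup.closure s) : g ∈ permAut C := by
  rw [← Subgroup.mem_toSubmonoid, Subgroup.closure_toSubmonoid_of_finite] at hg
  exact (Submonoid.closure_le.mpr hs) hg

theorem wt_comp_perm {n : ℕ} {F : Type} [Zero F] (c : Fin n → F) (g : Equiv.Perm (Fin n)) :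
    wt (c ∘ g) = wt c := by
  unfold wt
  exact Finset.card_equiv g (by simp)

theorem subset_supp_comp_iff {n : ℕ} {F : Type} [Zero F] (c : Fin n → F)
    (g : Equiv.Perm (Fin n)) (T : Finset (Fin n)) :
    T ⊆ supp (c ∘ g) ↔ T.map g.toEmbedding ⊆ supp c := by
  rw [Finset.map_subset_iff_subset_preimage]
  simp [supp, Finset.subset_iff]

theorem ncard_shell_map_le {n : ℕ} {F : Type} [Zero F] [Finite F] {C : Set (Fin n → F)}
    {g : Equiv.Perm (Fin n)} (hg : g ∈ permAut C) (ℓ : ℕ) (T : Finset (Fin n)) :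
    {c | c ∈ C ∧ wt c = ℓ ∧ T.map g.toEmbedding ⊆ supp c}.ncard ≤
      {c | c ∈ C ∧ wt c = ℓ ∧ T ⊆ supp c}.ncard := by
  refine Set.ncard_le_ncard_of_injOn (fun c => c ∘ g) ?_ ?_ (Set.toFinite _)
  · rintro c ⟨hc, hw, hT⟩
    exact ⟨hg c hc, (wt_comp_perm c g).trans hw, (subset_supp_comp_iff c g T).mpr hT⟩
  · exact fun _ _ _ _ h => g.surjective.injective_comp_right h

/-- A set of words of length 18 invariant under `z ↦ z + 1` and `z ↦ -1 / z` has shells which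
are 2-designs. -/
theorem exists_ncard_shell_eq {F : Type} [Zero F] [Finite F] {C : Set (Fin 18 → F)}
    (hs : shiftPerm ∈ permAut C) (hn : negInvPerm ∈ permAut C) (ℓ : ℕ) :
    ∃ lam : ℕ, ∀ T : Finset (Fin 18), T.card = 2 →
      {c | c ∈ C ∧ wt c = ℓ ∧ T ⊆ supp c}.ncard = lam := by
  have hle : ∀ T U : Finset (Fin 18), T.card = 2 → U.card = 2 →
      {c | c ∈ C ∧ wt c = ℓ ∧ U ⊆ supp c}.ncard ≤
        {c | c ∈ C ∧ wt c = ℓ ∧ T ⊆ supp c}.ncard := fun T U hT hU => by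
    obtain ⟨g, hg, rfl⟩ := exists_mem_closure_map_eq hT hU
    refine ncard_shell_map_le (closure_le_permAut ?_ hg) ℓ T
    rintro _ (rfl | rfl)
    exacts [hs, hn]
  exact ⟨_, fun T hT => (hle {0, 1} T rfl hT).antisymm (hle T {0, 1} hT rfl)⟩

/-! ### Codes over `F4` with binary parity checks -/

/-- The words over `F4` satisfying the parity checks given by the rows of a binary matrix. -/
def parityCheckCode {m n : ℕ} (H : Matrix (Fin m) (Fin n) (ZMod 2)) : Set (Fin n → F4) :=
  {c | Matrix.mulVec (H.map (algebraMap (ZMod 2) F4)) c = 0}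

theorem mem_permAut_parityCheckCode {m n : ℕ} {H : Matrix (Fin m) (Fin n) (ZMod 2)}
    {g : Equiv.Perm (Fin n)} (A : Matrix (Fin m) (Fin m) (ZMod 2))
    (hA : H.submatrix id g.symm = A * H) : g ∈ permAut (parityCheckCode H) := by
  intro c hc
  have h : Matrix.mulVec ((H.submatrix id g.symm).map (algebraMap (ZMod 2) F4)) c = 0 := by
    rw [hA, Matrix.map_mul, ← Matrix.mulVec_mulVec, show Matrix.mulVec _ c = 0 from hc,
      Matrix.mulVec_zero]
  have h' := Matrix.submatrix_mulVec_equiv (H.map (algebraMap (ZMod 2) F4)) c id g.symm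
  rw [Matrix.submatrix_map] at h'
  funext k
  exact (congrFun h' k).symm.trans (congrFun h k)

/-- The first eight rows of `H` give, in the column of `i < 17`, the coefficients of the
remainder of `X ^ i` modulo the octic polynomial whose lower coefficients are in column `8`;
the last row is the overall parity check. -/
structure IsCyclicParityCheck (H : Matrix (Fin 9) (Fin 18) (ZMod 2)) : Prop where
  col_zero : ∀ k : Fin 8, H k.castSucc 0 = if k = 0 then 1 else 0
  col_succ_zero : ∀ i : Fin 16,
    H 0 i.succ.castSucc = H 7 i.castSucc.castSucc * H 0 8
  col_succ_succ : ∀ (i : Fin 16) (k : Fin 7), H k.succ.castSucc i.succ.castSucc =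
    H k.castSucc.castSucc i.castSucc.castSucc + H 7 i.castSucc.castSucc * H k.succ.castSucc 8
  col_last : ∀ k : Fin 8, H k.castSucc (Fin.last 17) = 0
  row_last : ∀ i : Fin 18, H (Fin.last 8) i = 1

/-- The element `x` is a root of the octic polynomial whose lower coefficients are in column
`8` of `H`. -/
def IsOcticRoot {K : Type} [Field K] [Algebra F4 K] (H : Matrix (Fin 9) (Fin 18) (ZMod 2))
    (x : K) : Prop :=
  x ^ 8 = ∑ k : Fin 8,
    algebraMap F4 K (algebraMap (ZMod 2) F4 (H k.castSucc 8)) * x ^ (k : ℕ)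

theorem pow_two_pow_injective {K : Type} [Field K] {α : K} (hα : IsPrimitiveRoot α 17) :
    Function.Injective fun j : Fin 8 => α ^ 2 ^ (j : ℕ) := by
  intro i j hij
  have hd : ∀ i j : Fin 8, 2 ^ (i : ℕ) ≡ 2 ^ (j : ℕ) [MOD 17] → i = j := by
    unfold Nat.ModEq
    decide
  refine hd i j ?_
  rwa [hα.eq_orderOf, ← (hα.isOfFinOrder (by norm_num)).pow_eq_pow_iff_modEq]

section Field

variable {K : Type} [Field K] [Algebra F4 K] {H : Matrix (Fin 9) (Fin 18) (ZMod 2)}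

theorem charP_two_of_algebra_F4 (K : Type) [Field K] [Algebra F4 K] : CharP K 2 :=
  charP_of_injective_algebraMap (algebraMap F4 K).injective 2

theorem IsOcticRoot.sq {x : K} (hx : IsOcticRoot H x) : IsOcticRoot H (x ^ 2) := by
  have := charP_two_of_algebra_F4 K
  have h := congrArg (frobenius K 2) hx
  simp only [map_sum, map_mul, map_pow, frobenius_def] at h
  unfold IsOcticRoot
  rw [h]
  refine Finset.sum_congr rfl fun k _ => ?_
  rw [← map_pow, ← map_pow, ZMod.pow_card]

theorem IsOcticRoot.pow_two_pow {x : K} (hx : IsOcticRoot H x) (j : ℕ) :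
    IsOcticRoot H (x ^ 2 ^ j) := by
  induction j with
  | zero => simpa using hx
  | succ j ih => simpa [pow_succ, pow_mul] using ih.sq

theorem IsCyclicParityCheck.pow_eq_sum (hH : IsCyclicParityCheck H) {x : K}
    (hx : IsOcticRoot H x) (i : Fin 17) :
    x ^ (i : ℕ) = ∑ k : Fin 8,
      algebraMap F4 K (algebraMap (ZMod 2) F4 (H k.castSucc i.castSucc)) * x ^ (k : ℕ) := by
  induction i using Fin.induction with
  | zero => simp [hH.col_zero]
  | succ i ih =>
    unfold IsOcticRoot at hx
    rw [Fin.val_succ, pow_succ, ← Fin.val_castSucc, ih, Fin.sum_univ_castSucc, add_mul, mul_assoc,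
      ← pow_succ, Fin.val_last, hx, Fin.sum_univ_succ (n := 7),
      Fin.sum_univ_succ (n := 7)]
    simp only [hH.col_succ_succ, Fin.castSucc_zero, hH.col_succ_zero, Finset.sum_mul, mul_add,
      Finset.mul_sum, map_add, map_mul, add_mul, Finset.sum_add_distrib, Fin.val_succ,
      Fin.val_castSucc, pow_succ, Fin.reduceLast, Fin.reduceCastSucc, mul_assoc, Fin.val_zero]
    ring

/-- Since the nonzero squares modulo 17 are the powers of 2, it suffices to check the roots
`α ^ 2 ^ j`. -/
theorem qr4Mem_iff {α : K} (hα : IsPrimitiveRoot α 17) (c : Fin 17 → F4) :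
    qr4Mem α c ↔ ∀ j : Fin 8,
      ∑ i : Fin 17, algebraMap F4 K (c i) * (α ^ 2 ^ (j : ℕ)) ^ (i : ℕ) = 0 := by
  have hpow : ∀ a b : ℕ, (a : ZMod 17) = b → α ^ a = α ^ b := fun a b h => by
    rw [(hα.isOfFinOrder (by norm_num)).pow_eq_pow_iff_modEq, ← hα.eq_orderOf]
    exact (ZMod.natCast_eq_natCast_iff _ _ _).mp h
  constructor
  · intro h j
    have hs : ∀ j : Fin 8, (2 : ZMod 17) ^ (j : ℕ) ≠ 0 ∧
        (2 : ZMod 17) ^ (j : ℕ) = 6 ^ (j : ℕ) * 6 ^ (j : ℕ) := by decide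
    rw [← h (2 ^ (j : ℕ)) (hs j).1 ⟨_, (hs j).2⟩]
    refine Finset.sum_congr rfl fun i _ => ?_
    rw [← pow_mul, hpow (2 ^ (j : ℕ) * i) (((2 : ZMod 17) ^ (j : ℕ)).val * i) (by simp)]
  · rintro h _ h0 ⟨r, rfl⟩
    have hs : ∀ r : ZMod 17, r * r ≠ 0 → ∃ j : Fin 8, r * r = 2 ^ (j : ℕ) := by decide
    obtain ⟨j, hj⟩ := hs r h0
    rw [← h j]
    refine Finset.sum_congr rfl fun i _ => ?_
    rw [← pow_mul, hpow (2 ^ (j : ℕ) * i) ((r * r).val * i) (by simp [← hj])]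

theorem IsCyclicParityCheck.sum_mul_pow (hH : IsCyclicParityCheck H) {x : K}
    (hx : IsOcticRoot H x) (c : Fin 17 → F4) :
    ∑ i : Fin 17, algebraMap F4 K (c i) * x ^ (i : ℕ) =
      ∑ k : Fin 8, algebraMap F4 K
        (∑ i : Fin 17, algebraMap (ZMod 2) F4 (H k.castSucc i.castSucc) * c i) * x ^ (k : ℕ) := by
  simp_rw [hH.pow_eq_sum hx, map_sum, map_mul, Finset.mul_sum, Finset.sum_mul]
  rw [Finset.sum_comm]
  exact Finset.sum_congr rfl fun k _ => Finset.sum_congr rfl fun i _ => by ring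

theorem IsCyclicParityCheck.qr4Mem_iff (hH : IsCyclicParityCheck H) {α : K}
    (hα : IsPrimitiveRoot α 17) (hx : IsOcticRoot H α) (c : Fin 17 → F4) :
    qr4Mem α c ↔ ∀ k : Fin 8,
      ∑ i : Fin 17, algebraMap (ZMod 2) F4 (H k.castSucc i.castSucc) * c i = 0 := by
  rw [_root_.qr4Mem_iff hα]
  simp_rw [hH.sum_mul_pow (hx.pow_two_pow _)]
  constructor
  · intro h k
    have h0 := Matrix.eq_zero_of_forall_index_sum_mul_pow_eq_zero (pow_two_pow_injective hα) h
    exact (map_eq_zero _).mp (congrFun h0 k)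
  · intro h j
    simp [h]

theorem IsCyclicParityCheck.extQR4Mem_iff (hH : IsCyclicParityCheck H) {α : K}
    (hα : IsPrimitiveRoot α 17) (hx : IsOcticRoot H α) (c : Fin 18 → F4) :
    extQR4Mem α c ↔ c ∈ parityCheckCode H := by
  rw [extQR4Mem, hH.qr4Mem_iff hα hx, eq_neg_iff_add_eq_zero, parityCheckCode, Set.mem_ofPred_eq,
    funext_iff, Fin.forall_fin_succ' (n := 8), add_comm (c _)]
  simp only [Matrix.mulVec, dotProduct, Matrix.map_apply, Fin.sum_univ_castSucc (n := 17),
    hH.col_last, hH.row_last, map_zero, zero_mul, add_zero, map_one, one_mul, Pi.zero_apply]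

end Field

/-! ### The two binary quadratic residue codes -/

/-- A parity check matrix for the octic `X ^ 8 + X ^ 5 + X ^ 4 + X ^ 3 + 1`. -/
def qrCheck₁ : Matrix (Fin 9) (Fin 18) (ZMod 2) :=
  !![1, 0, 0, 0, 0, 0, 0, 0, 1, 0, 0, 1, 1, 1, 1, 0, 0, 0;
    0, 1, 0, 0, 0, 0, 0, 0, 0, 1, 0, 0, 1, 1, 1, 1, 0, 0;
    0, 0, 1, 0, 0, 0, 0, 0, 0, 0, 1, 0, 0, 1, 1, 1, 1, 0;
    0, 0, 0, 1, 0, 0, 0, 0, 1, 0, 0, 0, 1, 1, 0, 1, 1, 0;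
    0, 0, 0, 0, 1, 0, 0, 0, 1, 1, 0, 1, 1, 0, 0, 0, 1, 0;
    0, 0, 0, 0, 0, 1, 0, 0, 1, 1, 1, 1, 0, 0, 1, 0, 0, 0;
    0, 0, 0, 0, 0, 0, 1, 0, 0, 1, 1, 1, 1, 0, 0, 1, 0, 0;
    0, 0, 0, 0, 0, 0, 0, 1, 0, 0, 1, 1, 1, 1, 0, 0, 1, 0;
    1, 1, 1, 1, 1, 1, 1, 1, 1, 1, 1, 1, 1, 1, 1, 1, 1, 1]

/-- A parity check matrix for the octic `X ^ 8 + X ^ 7 + X ^ 6 + X ^ 4 + X ^ 2 + X + 1`. -/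
def qrCheck₂ : Matrix (Fin 9) (Fin 18) (ZMod 2) :=
  !![1, 0, 0, 0, 0, 0, 0, 0, 1, 1, 0, 1, 0, 0, 1, 0, 1, 0;
    0, 1, 0, 0, 0, 0, 0, 0, 1, 0, 1, 1, 1, 0, 1, 1, 1, 0;
    0, 0, 1, 0, 0, 0, 0, 0, 1, 0, 0, 0, 1, 1, 1, 1, 0, 0;
    0, 0, 0, 1, 0, 0, 0, 0, 0, 1, 0, 0, 0, 1, 1, 1, 1, 0;
    0, 0, 0, 0, 1, 0, 0, 0, 1, 1, 1, 1, 0, 0, 0, 1, 0, 0;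
    0, 0, 0, 0, 0, 1, 0, 0, 0, 1, 1, 1, 1, 0, 0, 0, 1, 0;
    0, 0, 0, 0, 0, 0, 1, 0, 1, 1, 1, 0, 1, 1, 1, 0, 1, 0;
    0, 0, 0, 0, 0, 0, 0, 1, 1, 0, 1, 0, 0, 1, 0, 1, 1, 0;
    1, 1, 1, 1, 1, 1, 1, 1, 1, 1, 1, 1, 1, 1, 1, 1, 1, 1]

theorem isCyclicParityCheck_qrCheck₁ : IsCyclicParityCheck qrCheck₁ := by
  constructor <;> decide +kernel

theorem isCyclicParityCheck_qrCheck₂ : IsCyclicParityCheck qrCheck₂ := by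
  constructor <;> decide +kernel

/-- The matrix which must express the rows of `H` permuted by `g` through those of `H`, read
off from the first eight columns and the last one. -/
def rowTransform (H : Matrix (Fin 9) (Fin 18) (ZMod 2)) (g : Equiv.Perm (Fin 18)) :
    Matrix (Fin 9) (Fin 9) (ZMod 2) :=
  Matrix.of fun k j => H k (g.symm 17) + if j = 8 then 0
    else H k (g.symm (Fin.castLE (by simp) j))

theorem qrCheck₁_submatrix : ∀ g ∈ [shiftPerm, negInvPerm],
    qrCheck₁.submatrix id g.symm = rowTransform qrCheck₁ g * qrCheck₁ := by
  simp only [← Matrix.ext_iff, Matrix.mul_apply, Matrix.submatrix_apply, id, List.forall_mem_cons]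
  exact ⟨by decide +kernel, by decide +kernel, by simp⟩

theorem qrCheck₂_submatrix : ∀ g ∈ [shiftPerm, negInvPerm],
    qrCheck₂.submatrix id g.symm = rowTransform qrCheck₂ g * qrCheck₂ := by
  simp only [← Matrix.ext_iff, Matrix.mul_apply, Matrix.submatrix_apply, id, List.forall_mem_cons]
  exact ⟨by decide +kernel, by decide +kernel, by simp⟩

theorem isOcticRoot_qrCheck {K : Type} [Field K] [Algebra F4 K] {α : K}
    (hα : IsPrimitiveRoot α 17) : IsOcticRoot qrCheck₁ α ∨ IsOcticRoot qrCheck₂ α := by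
  have := charP_two_of_algebra_F4 K
  have h2 : (2 : K) = 0 := CharTwo.two_eq_zero
  have h17 := hα.pow_eq_one
  have h1 : α - 1 ≠ 0 := sub_ne_zero.mpr (hα.ne_one (by norm_num))
  have hprod : (α - 1) * ((α ^ 8 - (1 + α ^ 3 + α ^ 4 + α ^ 5)) *
      (α ^ 8 - (1 + α + α ^ 2 + α ^ 4 + α ^ 6 + α ^ 7))) = 0 := by
    grind
  rcases mul_eq_zero.mp ((mul_eq_zero.mp hprod).resolve_left h1) with h | h
  · left
    simp [IsOcticRoot, Fin.sum_univ_eight, qrCheck₁, sub_eq_zero.mp h]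
  · right
    simp [IsOcticRoot, Fin.sum_univ_eight, qrCheck₂, sub_eq_zero.mp h]

/-- For the extended quaternary quadratic residue code `C` of length 18 (defined via any
fixed primitive 17th root of unity `α` in an extension of `𝔽₄`), every nonempty shell `C_ℓ`
with `2 ≤ ℓ ≤ 18` and `ℓ ≠ 13` is a combinatorial `2`-`(18, ℓ, λ)` design (with repeated
blocks). -/
theorem quaternary_shells_two_design (K : Type) [Field K] [Algebra F4 K] (α : K)
    (hα : IsPrimitiveRoot α 17) (ℓ : ℕ) (h2 : 2 ≤ ℓ) (h18 : ℓ ≤ 18) (h13 : ℓ ≠ 13)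
    (hne : ∃ c : Fin 18 → F4, extQR4Mem α c ∧ wt c = ℓ) :
    ∃ lam : ℕ, ∀ T : Finset (Fin 18), T.card = 2 →
      {c : Fin 18 → F4 | extQR4Mem α c ∧ wt c = ℓ ∧ T ⊆ supp c}.ncard = lam := by
  have hcode : ∃ C : Set (Fin 18 → F4), (∀ c, extQR4Mem α c ↔ c ∈ C) ∧
      shiftPerm ∈ permAut C ∧ negInvPerm ∈ permAut C := by
    rcases isOcticRoot_qrCheck hα with h | h
    · exact ⟨_, isCyclicParityCheck_qrCheck₁.extQR4Mem_iff hα h,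
        mem_permAut_parityCheckCode _ (qrCheck₁_submatrix _ (by simp)),
        mem_permAut_parityCheckCode _ (qrCheck₁_submatrix _ (by simp))⟩
    · exact ⟨_, isCyclicParityCheck_qrCheck₂.extQR4Mem_iff hα h,
        mem_permAut_parityCheckCode _ (qrCheck₂_submatrix _ (by simp)),
        mem_permAut_parityCheckCode _ (qrCheck₂_submatrix _ (by simp))⟩
  obtain ⟨C, hC, hs, hn⟩ := hcode
  simp only [hC]
  exact exists_ncard_shell_eq hs hn ℓ
end
end

section
/- Let C be the extended quaternary quadratic residue code of length 18. The shell C_13 is not a combinatorial 4-design with repeated blocks: there exist 4-element subsets T and T′ of {1,…,18} such that the number of codewords c ∈ C with wt(c) = 13 and T ⊆ supp(c) differs from the number of codewords c ∈ C with wt(c) = 13 and T′ ⊆ supp(c). -/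
open scoped Classical

noncomputable section

/-- The nonzero squares modulo 17. -/
def squares17 : Finset (ZMod 17) := {1, 2, 4, 8, 9, 13, 15, 16}

/-- The nonsquares modulo 17. -/
def nonsquares17 : Finset (ZMod 17) := {3, 5, 6, 7, 10, 11, 12, 14}

lemma mem_squares17 (l : ZMod 17) : l ∈ squares17 ↔ l ≠ 0 ∧ IsSquare l := by
  constructor
  · intro h
    have key : ∀ l ∈ squares17, l ≠ 0 ∧ ∃ r, l = r * r := by decide
    exact key l h
  · rintro ⟨h, r, rfl⟩
    revert r
    decide

/-- The parity checks on the first 17 coordinates given by the translates of `S`, together with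
the overall parity check. -/
def ParityChecks {M : Type*} [AddCommGroup M] (S : Finset (ZMod 17)) (c : Fin 18 → M) : Prop :=
  (∀ j : ZMod 17,
      ∑ i : Fin 17, (if ((i : ℕ) : ZMod 17) + j ∈ S then c i.castSucc else 0) = 0) ∧
    c (Fin.last 17) = - ∑ i : Fin 17, c i.castSucc

lemma sum_squares17_mul {M : Type*} [AddCommMonoid M] (f : ZMod 17 → M) (k : ZMod 17) :
    ∑ l ∈ squares17, f (l * k) =
      if k = 0 then 8 • f 0 else
        if k ∈ squares17 then ∑ l ∈ squares17, f l else ∑ l ∈ nonsquares17, f l := by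
  by_cases hk : k = 0
  · subst hk
    have h : squares17.card = 8 := by decide
    simp [h]
  · have himage : ∀ k : ZMod 17, k ≠ 0 →
        squares17.image (· * k) = if k ∈ squares17 then squares17 else nonsquares17 := by
      decide
    have hinj : Set.InjOn (· * k) (squares17 : Set (ZMod 17)) :=
      fun a _ b _ h => by
        have : Fact (Nat.Prime 17) := ⟨by norm_num⟩
        exact mul_right_cancel₀ hk h
    rw [← Finset.sum_image (f := f) hinj]
    have h := himage k hk
    rw [if_neg hk]
    split_ifs with hs
    · rw [if_pos hs] at h
      convert rfl using 2
      convert h.symm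
    · rw [if_neg hs] at h
      convert rfl using 2
      convert h.symm

section Periods

variable {K : Type} [Field K] [CharP K 2] {ψ : AddChar (ZMod 17) K}

lemma sum_addChar_squares_add_nonsquares (hψ : ψ.IsPrimitive) :
    ∑ l ∈ squares17, ψ l + ∑ l ∈ nonsquares17, ψ l = 1 := by
  have h := AddChar.sum_mulShift (1 : ZMod 17) hψ
  rw [if_neg (by decide)] at h
  have huniv : (Finset.univ : Finset (ZMod 17)) = insert 0 (squares17 ∪ nonsquares17) := by
    decide
  have hdisj : Disjoint squares17 nonsquares17 := by decide
  have hzero : (0 : ZMod 17) ∉ squares17 ∪ nonsquares17 := by decide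
  simp only [mul_one, Nat.cast_zero] at h
  rw [huniv, Finset.sum_insert hzero, Finset.sum_union hdisj, AddChar.map_zero_eq_one] at h
  rw [← CharTwo.neg_eq (1 : K)]
  linear_combination h

lemma sum_addChar_squares_eq_zero_or_one :
    ∑ l ∈ squares17, ψ l = 0 ∨ ∑ l ∈ squares17, ψ l = 1 := by
  have h := sum_squares17_mul (fun k => ψ k) 2
  rw [if_neg (by decide), if_pos (by decide)] at h
  have hsq : (∑ l ∈ squares17, ψ l) ^ 2 = ∑ l ∈ squares17, ψ l := by
    rw [CharTwo.sum_sq]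
    refine Eq.trans (Finset.sum_congr rfl fun l _ => ?_) h
    rw [mul_two, AddChar.map_add_eq_mul, sq]
  have hmul : (∑ l ∈ squares17, ψ l) * (∑ l ∈ squares17, ψ l - 1) = 0 := by
    linear_combination hsq
  rcases mul_eq_zero.mp hmul with h0 | h1
  · exact Or.inl h0
  · exact Or.inr (sub_eq_zero.mp h1)

/-- The Gauss periods of degree two over a field of characteristic two take values in
`{0, 1}`, and are supported either on the squares or on the nonsquares. -/
lemma exists_period_eq_indicator (hψ : ψ.IsPrimitive) :
    ∃ S : Finset (ZMod 17), (S = squares17 ∨ S = nonsquares17) ∧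
      ∀ k, ∑ l ∈ squares17, ψ (l * k) = if k ∈ S then 1 else 0 := by
  have hcases : ∀ k : ZMod 17, k ≠ 0 → (k ∈ nonsquares17 ↔ k ∉ squares17) := by decide
  have hadd := sum_addChar_squares_add_nonsquares hψ
  have h8 : (8 : K) = 0 := by
    have h2 : (2 : K) = 0 := CharTwo.two_eq_zero
    linear_combination 4 * h2
  have h0s : (0 : ZMod 17) ∉ squares17 := by decide
  have h0n : (0 : ZMod 17) ∉ nonsquares17 := by decide
  rcases sum_addChar_squares_eq_zero_or_one (ψ := ψ) with h | h
  · refine ⟨nonsquares17, Or.inr rfl, fun k => ?_⟩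
    rw [h, zero_add] at hadd
    rw [sum_squares17_mul (fun k => ψ k) k]
    by_cases hk : k = 0
    · simp [hk, h0n, h8]
    · by_cases hs : k ∈ squares17 <;> simp [hk, hs, hcases k hk, h, hadd]
  · refine ⟨squares17, Or.inl rfl, fun k => ?_⟩
    rw [h, add_eq_left] at hadd
    rw [sum_squares17_mul (fun k => ψ k) k]
    by_cases hk : k = 0
    · simp [hk, h0s, h8]
    · by_cases hs : k ∈ squares17 <;> simp [hk, hs, h, hadd]

/-- Vanishing at the square powers of a primitive 17th root of unity is equivalent to
parity checks with coefficients in the prime field. -/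
lemma forall_squares_sum_eq_zero_iff (hψ : ψ.IsPrimitive) {S : Finset (ZMod 17)}
    (hS : ∀ k, ∑ l ∈ squares17, ψ (l * k) = if k ∈ S then 1 else 0) (c : Fin 17 → K) :
    (∀ l ∈ squares17, ∑ i : Fin 17, c i * ψ (l * ((i : ℕ) : ZMod 17)) = 0) ↔
      ∀ j : ZMod 17, ∑ i : Fin 17, (if ((i : ℕ) : ZMod 17) + j ∈ S then c i else 0) = 0 := by
  have hcheck : ∀ j : ZMod 17,
      ∑ i : Fin 17, (if ((i : ℕ) : ZMod 17) + j ∈ S then c i else 0) =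
        ∑ l ∈ squares17, ψ (l * j) * ∑ i : Fin 17, c i * ψ (l * ((i : ℕ) : ZMod 17)) := by
    intro j
    simp_rw [Finset.mul_sum]
    rw [Finset.sum_comm]
    refine Finset.sum_congr rfl fun i _ => ?_
    have h := hS (((i : ℕ) : ZMod 17) + j)
    simp_rw [mul_add, AddChar.map_add_eq_mul] at h
    calc (if ((i : ℕ) : ZMod 17) + j ∈ S then c i else 0)
        = c i * (if ((i : ℕ) : ZMod 17) + j ∈ S then 1 else 0) := by split_ifs <;> simp
      _ = _ := by
        rw [← h, Finset.mul_sum]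
        exact Finset.sum_congr rfl fun l _ => by ring
  constructor
  · intro h j
    rw [hcheck]
    exact Finset.sum_eq_zero fun l hl => by rw [h l hl, mul_zero]
  · intro h m hm
    have hinv : ∑ j : ZMod 17, ψ (j * -m) * ∑ l ∈ squares17,
        ψ (l * j) * ∑ i : Fin 17, c i * ψ (l * ((i : ℕ) : ZMod 17)) = 0 :=
      Finset.sum_eq_zero fun j _ => by rw [← hcheck, h j, mul_zero]
    simp_rw [Finset.mul_sum (s := squares17)] at hinv
    rw [Finset.sum_comm] at hinv
    have horth : ∀ l ∈ squares17, (∑ j : ZMod 17, ψ (j * -m) * (ψ (l * j) *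
        ∑ i : Fin 17, c i * ψ (l * ((i : ℕ) : ZMod 17)))) =
          if l = m then ∑ i : Fin 17, c i * ψ (m * ((i : ℕ) : ZMod 17)) else 0 := by
      intro l _
      have hs := AddChar.sum_mulShift (l - m) hψ
      simp_rw [← mul_assoc, ← AddChar.map_add_eq_mul]
      rw [← Finset.sum_mul]
      have hre : ∀ j : ZMod 17, j * -m + l * j = j * (l - m) := fun j => by ring
      simp_rw [hre]
      rw [hs]
      by_cases hlm : l = m
      · have h2 : (2 : K) = 0 := CharTwo.two_eq_zero
        subst hlm
        simp only [sub_self, if_true, ZMod.card]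
        push_cast
        linear_combination 8 * (∑ i : Fin 17, c i * ψ (l * ((i : ℕ) : ZMod 17))) * h2
      · simp [hlm, sub_eq_zero]
    rw [Finset.sum_congr rfl horth, Finset.sum_ite_eq' squares17 m, if_pos hm] at hinv
    exact hinv

end Periods

lemma exists_extQR4Mem_iff {K : Type} [Field K] [Algebra F4 K] {α : K}
    (hα : IsPrimitiveRoot α 17) :
    ∃ S : Finset (ZMod 17), (S = squares17 ∨ S = nonsquares17) ∧
      ∀ c, extQR4Mem α c ↔ ParityChecks S c := by
  have : CharP K 2 := charP_of_injective_algebraMap (algebraMap F4 K).injective 2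
  have hψ := AddChar.zmodChar_primitive_of_primitive_root 17 hα
  obtain ⟨S, hS, hperiod⟩ := exists_period_eq_indicator hψ
  refine ⟨S, hS, fun c => and_congr_left fun _ => ?_⟩
  have hiff := forall_squares_sum_eq_zero_iff hψ hperiod
    (fun i => algebraMap F4 K (c i.castSucc))
  have hleft : qr4Mem α (fun i => c i.castSucc) ↔
      ∀ l ∈ squares17, ∑ i : Fin 17, algebraMap F4 K (c i.castSucc) *
        AddChar.zmodChar 17 hα.pow_eq_one (l * ((i : ℕ) : ZMod 17)) = 0 := by
    simp only [qr4Mem, mem_squares17, and_imp]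
    refine forall_congr' fun l => imp_congr_right fun _ => imp_congr_right fun _ => ?_
    refine Eq.congr_left (Finset.sum_congr rfl fun i _ => ?_)
    rw [AddChar.zmodChar_apply, ZMod.val_mul, ← pow_eq_pow_mod _ hα.pow_eq_one,
      ZMod.val_natCast, Nat.mod_eq_of_lt i.isLt]
  rw [hleft, hiff]
  refine forall_congr' fun j => ?_
  rw [← map_eq_zero_iff _ (algebraMap F4 K).injective, map_sum]
  simp only [apply_ite (algebraMap F4 K), map_zero]

namespace ParityChecks

variable {M N : Type*} [AddCommGroup M] [AddCommGroup N] {S : Finset (ZMod 17)}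

lemma map {c : Fin 18 → M} (hc : ParityChecks S c) (f : M →+ N) :
    ParityChecks S fun i => f (c i) := by
  refine ⟨fun j => ?_, ?_⟩
  · have h := congrArg f (hc.1 j)
    simpa only [map_sum, apply_ite f, map_zero] using h
  · simpa only [map_neg, map_sum] using congrArg f hc.2

lemma sub {c d : Fin 18 → M} (hc : ParityChecks S c) (hd : ParityChecks S d) :
    ParityChecks S fun i => c i - d i := by
  refine ⟨fun j => ?_, ?_⟩
  · have h := congrArg₂ (· - ·) (hc.1 j) (hd.1 j)
    simp only [← Finset.sum_sub_distrib, sub_self] at h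
    refine Eq.trans (Finset.sum_congr rfl fun i _ => ?_) h
    split_ifs <;> simp
  · simp only [hc.2, hd.2, Finset.sum_sub_distrib]
    abel

lemma prodMk {c : Fin 18 → M} {d : Fin 18 → N} (hc : ParityChecks S c)
    (hd : ParityChecks S d) : ParityChecks S fun i => (c i, d i) := by
  refine ⟨fun j => Prod.ext ?_ ?_, Prod.ext ?_ ?_⟩
  · rw [Prod.fst_sum, Prod.fst_zero, ← hc.1 j]
    exact Finset.sum_congr rfl fun i _ => by split_ifs <;> rfl
  · rw [Prod.snd_sum, Prod.snd_zero, ← hd.1 j]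
    exact Finset.sum_congr rfl fun i _ => by split_ifs <;> rfl
  · rw [Prod.fst_neg, Prod.fst_sum]
    exact hc.2
  · rw [Prod.snd_neg, Prod.snd_sum]
    exact hd.2

end ParityChecks

/-- A boolean word as a word over the field with two elements. -/
def boolWord {n : ℕ} (b : Fin n → Bool) (i : Fin n) : ZMod 2 :=
  if b i then 1 else 0

lemma boolWord_injective {n : ℕ} : Function.Injective (boolWord (n := n)) := by
  intro b d h
  have key : ∀ x y : Bool,
      (if x then (1 : ZMod 2) else 0) = (if y then 1 else 0) → x = y := by decide
  exact funext fun i => key _ _ (congrFun h i)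

lemma boolWord_xor {n : ℕ} (b d : Fin n → Bool) :
    boolWord (fun i => b i ^^ d i) = fun i => boolWord b i - boolWord d i := by
  have key : ∀ x y : Bool, (if (x ^^ y) then (1 : ZMod 2) else 0) =
      (if x then 1 else 0) - (if y then 1 else 0) := by decide
  exact funext fun i => key _ _

/-- The word of length 18 whose first nine bits are those of `m` and whose last nine bits are
those of `t m`. -/
def systematicWord (t : ℕ → ℕ) (m : ℕ) : Fin 18 → Bool :=
  Fin.append (m := 9) (n := 9) (fun i => m.testBit i) (fun i => (t m).testBit i)

lemma systematicWord_xor {t : ℕ → ℕ} {m n : ℕ} (h : t (m ^^^ n) = t m ^^^ t n) :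
    systematicWord t (m ^^^ n) = fun i => systematicWord t m i ^^ systematicWord t n i := by
  funext i
  refine Fin.addCases (m := 9) (n := 9) (fun i => ?_) (fun i => ?_) i
  · simp only [systematicWord, Fin.append_left, Nat.testBit_xor]
  · simp only [systematicWord, Fin.append_right, h, Nat.testBit_xor]

/-- The code with parity checks `S` is systematic on the first nine coordinates, with
redundancy `t`. -/
structure IsRedundancy (S : Finset (ZMod 17)) (t : ℕ → ℕ) : Prop where
  parityChecks : ∀ m < 512, ParityChecks S (boolWord (systematicWord t m))
  eq_zero : ∀ c : Fin 18 → ZMod 2, ParityChecks S c →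
    (∀ i : Fin 9, c (Fin.castAdd 9 i) = 0) → c = 0

/-- The linear map on bits sending the `i`-th unit vector to the `i`-th entry of the list. -/
def redundancy : List ℕ → ℕ → ℕ
  | [], _ => 0
  | r :: rows, m => (bif m.testBit 0 then r else 0) ^^^ redundancy rows (m >>> 1)

lemma redundancy_xor (rows : List ℕ) (m n : ℕ) :
    redundancy rows (m ^^^ n) = redundancy rows m ^^^ redundancy rows n := by
  induction rows generalizing m n with
  | nil => simp [redundancy]
  | cons r rows ih =>
    have hbit : (bif (m ^^^ n).testBit 0 then r else 0) =
        (bif m.testBit 0 then r else 0) ^^^ (bif n.testBit 0 then r else 0) := by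
      rw [Nat.testBit_xor]
      cases m.testBit 0 <;> cases n.testBit 0 <;> simp
    rw [redundancy, redundancy, redundancy, hbit, Nat.shiftRight_xor_distrib, ih]
    ac_rfl

/-- It is enough to verify the parity checks of a systematic code on the zero word and on the
rows of its generator matrix. -/
lemma parityChecks_systematicWord {S : Finset (ZMod 17)} {rows : List ℕ}
    (hzero : ParityChecks S (boolWord (systematicWord (redundancy rows) 0)))
    (hrow : ∀ i : Fin 9,
      ParityChecks S (boolWord (systematicWord (redundancy rows) (2 ^ (i : ℕ)))))
    (m : ℕ) (hm : m < 512) :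
    ParityChecks S (boolWord (systematicWord (redundancy rows) m)) := by
  have hlow : ∀ m : Fin 512, m ≠ 0 → ∃ i : Fin 9, (m : ℕ) ^^^ 2 ^ (i : ℕ) < m := by
    decide +kernel
  induction m using Nat.strong_induction_on with
  | _ m ih =>
    by_cases h0 : m = 0
    · rwa [h0]
    · obtain ⟨i, hlt⟩ := hlow ⟨m, hm⟩ (fun h => h0 (congrArg Fin.val h))
      have hword := systematicWord_xor (redundancy_xor rows (m ^^^ 2 ^ (i : ℕ)) (2 ^ (i : ℕ)))
      rw [Nat.xor_xor_cancel_right m] at hword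
      rw [hword, boolWord_xor]
      exact (ih _ hlt (hlt.trans hm)).sub (hrow i)

lemma sum_ite_eq_zero_of_mem_iff {M : Type*} [AddCommGroup M] {S : Finset (ZMod 17)}
    {c : Fin 18 → M} (hc : ParityChecks S c) (L : List ℕ)
    (hL : ∀ i j : Fin 17, ((i : ℕ) : ZMod 17) + ((j : ℕ) : ZMod 17) ∈ S ↔
      ((i : ℕ) + (j : ℕ)) % 17 ∈ L) (j : Fin 17) :
    ∑ i : Fin 17, (if ((i : ℕ) + (j : ℕ)) % 17 ∈ L then c i.castSucc else 0) = 0 := by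
  simpa only [hL] using hc.1 ((j : ℕ) : ZMod 17)

lemma eq_zero_of_parityChecks_squares17 (c : Fin 18 → ZMod 2) (hc : ParityChecks squares17 c)
    (h0 : ∀ i : Fin 9, c (Fin.castAdd 9 i) = 0) : c = 0 := by
  have hsum := sum_ite_eq_zero_of_mem_iff hc [1, 2, 4, 8, 9, 13, 15, 16] (by decide +kernel)
  have hlast := hc.2
  simp only [Fin.forall_fin_succ, Fin.sum_univ_succ] at h0 hsum hlast
  simp at h0 hsum hlast
  ext i
  fin_cases i <;> simp <;> grind

lemma eq_zero_of_parityChecks_nonsquares17 (c : Fin 18 → ZMod 2)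
    (hc : ParityChecks nonsquares17 c) (h0 : ∀ i : Fin 9, c (Fin.castAdd 9 i) = 0) : c = 0 := by
  have hsum := sum_ite_eq_zero_of_mem_iff hc [3, 5, 6, 7, 10, 11, 12, 14] (by decide +kernel)
  have hlast := hc.2
  simp only [Fin.forall_fin_succ, Fin.sum_univ_succ] at h0 hsum hlast
  simp at h0 hsum hlast
  ext i
  fin_cases i <;> simp <;> grind

/-- The redundancy of a systematic encoder of the code with parity checks `squares17`. -/
def squaresRedundancy : ℕ → ℕ :=
  redundancy [471, 121, 242, 307, 358, 460, 79, 158, 491]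

/-- The redundancy of a systematic encoder of the code with parity checks `nonsquares17`. -/
def nonsquaresRedundancy : ℕ → ℕ :=
  redundancy [313, 370, 484, 241, 475, 143, 295, 334, 412]

lemma isRedundancy_squaresRedundancy : IsRedundancy squares17 squaresRedundancy where
  parityChecks := parityChecks_systematicWord (by unfold ParityChecks; decide +kernel)
    (by unfold ParityChecks; decide +kernel)
  eq_zero := eq_zero_of_parityChecks_squares17

lemma isRedundancy_nonsquaresRedundancy : IsRedundancy nonsquares17 nonsquaresRedundancy where
  parityChecks := parityChecks_systematicWord (by unfold ParityChecks; decide +kernel)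
    (by unfold ParityChecks; decide +kernel)
  eq_zero := eq_zero_of_parityChecks_nonsquares17

lemma systematicWord_injOn (t : ℕ → ℕ) {m n : ℕ} (hm : m < 512) (hn : n < 512)
    (h : systematicWord t m = systematicWord t n) : m = n := by
  refine Nat.eq_of_testBit_eq fun i => ?_
  by_cases hi : i < 9
  · have := congrFun h (Fin.castAdd 9 ⟨i, hi⟩)
    simpa only [systematicWord, Fin.append_left] using this
  · have h512 : 512 ≤ 2 ^ i := Nat.pow_le_pow_right (n := 2) two_pos (not_lt.mp hi)
    rw [Nat.testBit_lt_two_pow (hm.trans_le h512), Nat.testBit_lt_two_pow (hn.trans_le h512)]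

lemma IsRedundancy.exists_eq {S : Finset (ZMod 17)} {t : ℕ → ℕ} (ht : IsRedundancy S t)
    {c : Fin 18 → ZMod 2} (hc : ParityChecks S c) :
    ∃ m < 512, c = boolWord (systematicWord t m) := by
  let b : Fin 9 → Bool := fun i => decide (c (Fin.castAdd 9 i) ≠ 0)
  have hlt : Nat.ofBits b < 512 := Nat.ofBits_lt_two_pow b
  refine ⟨Nat.ofBits b, hlt, ?_⟩
  have hzero := ht.eq_zero _ (hc.sub (ht.parityChecks _ hlt)) (fun i => ?_)
  · exact funext fun i => sub_eq_zero.mp (congrFun hzero i)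
  · have key : ∀ x : ZMod 2, x - (if x = 0 then 0 else 1) = 0 := by decide
    have hb : systematicWord t (Nat.ofBits b) (Fin.castAdd 9 i) = b i := by
      simp only [systematicWord, Fin.append_left]
      exact Nat.testBit_ofBits_lt b i i.isLt
    rw [boolWord, hb]
    simpa [b] using key (c (Fin.castAdd 9 i))

/-- The word over the field with four elements with the two given binary components. -/
def pairWord (e : F4 ≃+ ZMod 2 × ZMod 2) (b d : Fin 18 → Bool) (i : Fin 18) : F4 :=
  e.symm (boolWord b i, boolWord d i)

lemma pairWord_ne_zero_iff (e : F4 ≃+ ZMod 2 × ZMod 2) (b d : Fin 18 → Bool) (i : Fin 18) :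
    pairWord e b d i ≠ 0 ↔ (b i || d i) = true := by
  have key : ∀ x y : Bool, (if x then (1 : ZMod 2) else 0, if y then (1 : ZMod 2) else 0) ≠
      (0 : ZMod 2 × ZMod 2) ↔ (x || y) = true := by decide
  rw [pairWord, map_ne_zero_iff _ e.symm.injective]
  exact key _ _

set_option linter.constructorNameAsVariable false in
/-- Codewords over the field with four elements are parametrized by pairs of messages. -/
lemma IsRedundancy.setOf_parityChecks_eq {S : Finset (ZMod 17)} {t : ℕ → ℕ}
    (ht : IsRedundancy S t) (e : F4 ≃+ ZMod 2 × ZMod 2) (P : (Fin 18 → F4) → Prop) :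
    {c | ParityChecks S c ∧ P c}.ncard =
      ((Finset.range 512 ×ˢ Finset.range 512).filter fun p =>
        P (pairWord e (systematicWord t p.1) (systematicWord t p.2))).card := by
  rw [← Set.ncard_coe_finset, ← Set.InjOn.ncard_image
    (f := fun p : ℕ × ℕ => pairWord e (systematicWord t p.1) (systematicWord t p.2))]
  · congr 1
    ext c
    simp only [Set.mem_ofPred_eq, Set.mem_image, Finset.coe_filter, Finset.mem_product,
      Finset.mem_range]
    constructor
    · rintro ⟨hc, hP⟩
      obtain ⟨m, hm, hcm⟩ :=
        ht.exists_eq (hc.map ((AddMonoidHom.fst _ _).comp e.toAddMonoidHom))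
      obtain ⟨n, hn, hcn⟩ :=
        ht.exists_eq (hc.map ((AddMonoidHom.snd _ _).comp e.toAddMonoidHom))
      have hpair : pairWord e (systematicWord t m) (systematicWord t n) = c := by
        funext i
        rw [pairWord, ← hcm, ← hcn]
        exact e.symm_apply_apply (c i)
      exact ⟨(m, n), ⟨⟨hm, hn⟩, hpair ▸ hP⟩, hpair⟩
    · rintro ⟨⟨m, n⟩, ⟨⟨hm, hn⟩, hP⟩, rfl⟩
      exact ⟨((ht.parityChecks m hm).prodMk (ht.parityChecks n hn)).map e.symm.toAddMonoidHom,
        hP⟩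
  · rintro ⟨m, n⟩ hp ⟨m', n'⟩ hp' h
    simp only [Finset.coe_filter, Finset.mem_product, Finset.mem_range,
      Set.mem_ofPred_eq] at hp hp'
    have hpair : ∀ i, (boolWord (systematicWord t m) i, boolWord (systematicWord t n) i) =
        (boolWord (systematicWord t m') i, boolWord (systematicWord t n') i) :=
      fun i => e.symm.injective (congrFun h i)
    refine Prod.ext (systematicWord_injOn t hp.1.1 hp'.1.1 (boolWord_injective ?_))
      (systematicWord_injOn t hp.1.2 hp'.1.2 (boolWord_injective ?_))
    · exact funext fun i => congrArg Prod.fst (hpair i)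
    · exact funext fun i => congrArg Prod.snd (hpair i)

/-- The number of digits one among the last nine binary digits of `m`. -/
def popcount (m : ℕ) : ℕ :=
  ∑ i : Fin 9, if m.testBit i then 1 else 0

/-- The positions of the binary digits one of `a`. -/
def bitPositions (a : ℕ) : Finset (Fin 18) :=
  Finset.univ.filter fun i => a.testBit i = true

lemma wt_pairWord (t : ℕ → ℕ) (e : F4 ≃+ ZMod 2 × ZMod 2) (m n : ℕ) :
    wt (pairWord e (systematicWord t m) (systematicWord t n)) =
      popcount (m ||| n) + popcount (t m ||| t n) := by
  rw [popcount, popcount, wt, Finset.card_filter]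
  refine (Fin.sum_univ_add (a := 9) (b := 9) _).trans ?_
  simp only [pairWord_ne_zero_iff, systematicWord, Fin.append_left, Fin.append_right,
    Nat.testBit_or]

lemma disjoint_bitPositions_supp_iff (t : ℕ → ℕ) (e : F4 ≃+ ZMod 2 × ZMod 2) {a : ℕ}
    (ha : a < 512) (m n : ℕ) :
    Disjoint (bitPositions a) (supp (pairWord e (systematicWord t m) (systematicWord t n))) ↔
      m &&& a = 0 ∧ n &&& a = 0 := by
  have hbig : ∀ i, 9 ≤ i → a.testBit i = false := fun i hi =>
    Nat.testBit_lt_two_pow (ha.trans_le (Nat.pow_le_pow_right (n := 2) two_pos hi))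
  have hzero : ∀ m, m &&& a = 0 ↔ ∀ i : Fin 9, a.testBit i = true → m.testBit i = false := by
    refine fun m => ⟨fun h i hi => ?_, fun h => Nat.eq_of_testBit_eq fun i => ?_⟩
    · simpa [hi] using congrArg (fun x => x.testBit i) h
    · rw [Nat.testBit_and, Nat.zero_testBit]
      by_cases hi : i < 9
      · cases hb : a.testBit i
        · exact Bool.and_false _
        · rw [h ⟨i, hi⟩ hb, Bool.false_and]
      · rw [hbig i (not_lt.mp hi), Bool.and_false]
  rw [hzero, hzero, Finset.disjoint_left]
  simp only [bitPositions, supp, Finset.mem_filter, Finset.mem_univ, true_and,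
    pairWord_ne_zero_iff, Bool.not_eq_true, Bool.or_eq_false_iff]
  constructor
  · intro h
    have hleft : ∀ i : Fin 9, a.testBit i = true → m.testBit i = false ∧ n.testBit i = false :=
      fun i hi => by
        simpa only [systematicWord, Fin.append_left] using @h (Fin.castAdd 9 i) hi
    exact ⟨fun i hi => (hleft i hi).1, fun i hi => (hleft i hi).2⟩
  · rintro ⟨hm, hn⟩ i
    refine Fin.addCases (m := 9) (n := 9) (fun i hi => ?_) (fun i hi => ?_) i
    · simpa only [systematicWord, Fin.append_left] using ⟨hm i hi, hn i hi⟩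
    · rw [Fin.val_natAdd, hbig _ (Nat.le_add_right 9 _)] at hi
      exact absurd hi Bool.false_ne_true

/-- Summation of the values of `f` below `n`, in a form that reduces quickly. -/
def sumBelow (f : ℕ → ℕ) (n : ℕ) : ℕ :=
  Nat.rec 0 (fun k r => Nat.add r (f k)) n

lemma sumBelow_eq (f : ℕ → ℕ) (n : ℕ) : sumBelow f n = ∑ k ∈ Finset.range n, f k := by
  induction n with
  | zero => rfl
  | succ n ih =>
    rw [Finset.sum_range_succ, ← ih]
    rfl

/-- The number of pairs of messages whose words cover exactly 13 positions, none of them the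
position of a binary digit one of `a`. -/
def avoidingCount (t : ℕ → ℕ) (a : ℕ) : ℕ :=
  sumBelow (fun m => bif Nat.beq (Nat.land m a) 0 then
    sumBelow (fun n => bif Nat.beq (Nat.land n a) 0 then
      bif Nat.beq (popcount (m ||| n) + popcount (t m ||| t n)) 13 then 1 else 0 else 0) 512
    else 0) 512

lemma IsRedundancy.ncard_eq_avoidingCount {S : Finset (ZMod 17)} {t : ℕ → ℕ}
    (ht : IsRedundancy S t) {a : ℕ} (ha : a < 512) :
    {c : Fin 18 → F4 | ParityChecks S c ∧ wt c = 13 ∧ Disjoint (bitPositions a) (supp c)}.ncard =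
      avoidingCount t a := by
  have hrank : Module.finrank (ZMod 2) F4 = Module.finrank (ZMod 2) (ZMod 2 × ZMod 2) := by
    rw [GaloisField.finrank 2 two_ne_zero, Module.finrank_prod, Module.finrank_self]
  have e : F4 ≃+ ZMod 2 × ZMod 2 := (LinearEquiv.ofFinrankEq F4 _ hrank).toAddEquiv
  have hbeq : ∀ x y : ℕ, Nat.beq x y = decide (x = y) := fun x y => by
    rw [Bool.eq_iff_iff, Nat.beq_eq, decide_eq_true_eq]
  rw [ht.setOf_parityChecks_eq e, Finset.card_filter, Finset.sum_product, avoidingCount,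
    sumBelow_eq]
  refine Finset.sum_congr rfl fun m _ => ?_
  simp only [wt_pairWord t e, disjoint_bitPositions_supp_iff t e ha, hbeq, sumBelow_eq,
    Bool.cond_decide]
  change _ = if m &&& a = 0 then _ else 0
  by_cases hm : m &&& a = 0
  · simp only [hm, true_and, if_true]
    refine Finset.sum_congr rfl fun n _ => ?_
    change _ = if n &&& a = 0 then _ else 0
    by_cases hn : n &&& a = 0 <;> simp [hn]
  · simp [hm]

lemma avoidingCount_squaresRedundancy_ne :
    avoidingCount squaresRedundancy 15 ≠ avoidingCount squaresRedundancy 23 := by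
  decide +kernel

lemma avoidingCount_nonsquaresRedundancy_ne :
    avoidingCount nonsquaresRedundancy 15 ≠ avoidingCount nonsquaresRedundancy 23 := by
  decide +kernel

section Designs

variable {α β : Type*} [Fintype α] {F : Finset β} {s : β → Finset α} {w k : ℕ}

/-- In a design of strength `k + 1` the number of blocks through `k` points is constant. -/
lemma card_filter_superset_eq_of_succ (hs : ∀ b ∈ F, (s b).card = w) (hw : k < w)
    (hF : ∀ A A' : Finset α, A.card = k + 1 → A'.card = k + 1 →
      (F.filter fun b => A ⊆ s b).card = (F.filter fun b => A' ⊆ s b).card)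
    {A A' : Finset α} (hA : A.card = k) (hA' : A'.card = k) :
    (F.filter fun b => A ⊆ s b).card = (F.filter fun b => A' ⊆ s b).card := by
  have hcount : ∀ A : Finset α, A.card = k →
      ∑ x ∈ Aᶜ, (F.filter fun b => insert x A ⊆ s b).card =
        (F.filter fun b => A ⊆ s b).card * (w - k) := by
    intro A hA
    simp only [Finset.card_filter]
    rw [Finset.sum_comm, Finset.sum_mul]
    refine Finset.sum_congr rfl fun b hb => ?_
    by_cases hsub : A ⊆ s b
    · rw [if_pos hsub, one_mul, ← hs b hb, ← hA, ← Finset.card_sdiff_of_subset hsub,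
        ← Finset.card_filter]
      congr 1
      ext x
      simp [Finset.insert_subset_iff, hsub, and_comm]
    · rw [if_neg hsub, zero_mul]
      exact Finset.sum_eq_zero fun x _ =>
        if_neg fun h => hsub ((Finset.subset_insert x A).trans h)
  have hinsert : ∀ {A : Finset α}, A.card = k → ∀ x ∈ Aᶜ, (insert x A).card = k + 1 := by
    intro A hA x hx
    rw [Finset.card_insert_of_notMem (Finset.mem_compl.mp hx), hA]
  have hcard : Aᶜ.card = A'ᶜ.card := by rw [Finset.card_compl, Finset.card_compl, hA, hA']
  have key : ∑ x ∈ Aᶜ, (F.filter fun b => insert x A ⊆ s b).card =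
      ∑ x ∈ A'ᶜ, (F.filter fun b => insert x A' ⊆ s b).card := by
    rcases Finset.eq_empty_or_nonempty Aᶜ with h | ⟨y, hy⟩
    · rw [h, Finset.card_empty] at hcard
      rw [h, Finset.card_eq_zero.mp hcard.symm]
      simp
    · rw [Finset.sum_congr rfl fun x hx => hF _ _ (hinsert hA x hx) (hinsert hA y hy),
        Finset.sum_congr rfl fun x hx => hF _ _ (hinsert hA' x hx) (hinsert hA y hy),
        Finset.sum_const, Finset.sum_const, hcard]
  rw [hcount A hA, hcount A' hA'] at key
  exact Nat.eq_of_mul_eq_mul_right (Nat.sub_pos_of_lt hw) key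

/-- A design of strength `k` is a design of every smaller strength. -/
lemma card_filter_superset_eq_of_le (hs : ∀ b ∈ F, (s b).card = w) (hw : k ≤ w)
    (hF : ∀ A A' : Finset α, A.card = k → A'.card = k →
      (F.filter fun b => A ⊆ s b).card = (F.filter fun b => A' ⊆ s b).card)
    {j : ℕ} (hj : j ≤ k) : ∀ A A' : Finset α, A.card = j → A'.card = j →
      (F.filter fun b => A ⊆ s b).card = (F.filter fun b => A' ⊆ s b).card := by
  induction hj using Nat.decreasingInduction with
  | self => exact hF
  | of_succ j hj ih =>
    exact fun A A' hA hA' => card_filter_superset_eq_of_succ hs (hj.trans_le hw) ih hA hA'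

/-- In a design of strength `k`, the number of blocks containing `A` and avoiding `B` depends
only on the sizes of `A` and `B`, as long as these add up to at most `k`. -/
lemma card_filter_superset_disjoint_eq (hs : ∀ b ∈ F, (s b).card = w) (hw : k ≤ w)
    (hF : ∀ A A' : Finset α, A.card = k → A'.card = k →
      (F.filter fun b => A ⊆ s b).card = (F.filter fun b => A' ⊆ s b).card)
    (j : ℕ) {A A' B B' : Finset α} (hB : B.card = j) (hB' : B'.card = j)
    (hA : A.card = A'.card) (hAB : Disjoint A B) (hAB' : Disjoint A' B')
    (hk : A.card + j ≤ k) :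
    (F.filter fun b => A ⊆ s b ∧ Disjoint B (s b)).card =
      (F.filter fun b => A' ⊆ s b ∧ Disjoint B' (s b)).card := by
  induction j generalizing A A' B B' with
  | zero =>
    rw [Finset.card_eq_zero] at hB hB'
    simpa [hB, hB'] using card_filter_superset_eq_of_le hs hw hF hk A A' rfl hA.symm
  | succ j ih =>
    have hsplit : ∀ (x : α) (A B : Finset α),
        (F.filter fun b => A ⊆ s b ∧ Disjoint (insert x B) (s b)).card +
          (F.filter fun b => insert x A ⊆ s b ∧ Disjoint B (s b)).card =
            (F.filter fun b => A ⊆ s b ∧ Disjoint B (s b)).card := by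
      intro x A B
      rw [Finset.card_filter, Finset.card_filter, Finset.card_filter, ← Finset.sum_add_distrib]
      refine Finset.sum_congr rfl fun b _ => ?_
      by_cases hx : x ∈ s b <;> by_cases hsub : A ⊆ s b <;> by_cases hdis : Disjoint B (s b) <;>
        simp [Finset.insert_subset_iff, hx, hsub, hdis]
    obtain ⟨x, B, hx, rfl, hBj⟩ := Finset.card_eq_succ.mp hB
    obtain ⟨x', B', hx', rfl, hBj'⟩ := Finset.card_eq_succ.mp hB'
    rw [Finset.disjoint_insert_right] at hAB hAB'
    have h1 := ih hBj hBj' hA hAB.2 hAB'.2 (by lia)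
    have hins : (insert x A).card = A.card + 1 := Finset.card_insert_of_notMem hAB.1
    have hins' : (insert x' A').card = A'.card + 1 := Finset.card_insert_of_notMem hAB'.1
    have h2 := ih (A := insert x A) (A' := insert x' A') hBj hBj' (by lia)
      (Finset.disjoint_insert_left.mpr ⟨hx, hAB.2⟩)
      (Finset.disjoint_insert_left.mpr ⟨hx', hAB'.2⟩) (by lia)
    have h3 := hsplit x A B
    have h4 := hsplit x' A' B'
    lia

end Designs

/-- If all 4-sets are covered equally often by the supports of the codewords of weight 13, then
all 4-sets are avoided equally often. -/
lemma ncard_disjoint_supp_eq {P : (Fin 18 → F4) → Prop}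
    (hP : ∀ T T' : Finset (Fin 18), T.card = 4 → T'.card = 4 →
      {c | P c ∧ wt c = 13 ∧ T ⊆ supp c}.ncard = {c | P c ∧ wt c = 13 ∧ T' ⊆ supp c}.ncard)
    {T T' : Finset (Fin 18)} (hT : T.card = 4) (hT' : T'.card = 4) :
    {c | P c ∧ wt c = 13 ∧ Disjoint T (supp c)}.ncard =
      {c | P c ∧ wt c = 13 ∧ Disjoint T' (supp c)}.ncard := by
  have : Fintype F4 := Fintype.ofFinite F4
  have hncard : ∀ Q : (Fin 18 → F4) → Prop, {c | P c ∧ wt c = 13 ∧ Q c}.ncard =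
      ((Finset.univ.filter fun c => P c ∧ wt c = 13).filter Q).card := by
    intro Q
    rw [← Set.ncard_coe_finset, Finset.filter_filter, Finset.coe_filter]
    simp only [Finset.mem_univ, true_and, and_assoc]
  simp only [hncard] at hP ⊢
  have hwt : ∀ c ∈ (Finset.univ.filter fun c => P c ∧ wt c = 13), (supp c).card = 13 :=
    fun c hc => (Finset.mem_filter.mp hc).2.2
  have h := card_filter_superset_disjoint_eq (k := 4) (A := ∅) (A' := ∅) hwt (by norm_num)
    (fun A A' hA hA' => by convert hP A A' hA hA') 4 hT hT' rfl
    (Finset.disjoint_empty_left T) (Finset.disjoint_empty_left T') (by norm_num)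
  simp only [Finset.empty_subset, true_and] at h
  convert h

/-- For the extended quaternary quadratic residue code `C` of length 18, the shell `C₁₃` is
not a combinatorial 4-design with repeated blocks: some two 4-element subsets of the
coordinates are contained in different numbers of supports of codewords of weight 13. -/
theorem quaternary_shell_thirteen_not_four_design (K : Type) [Field K] [Algebra F4 K] (α : K)
    (hα : IsPrimitiveRoot α 17) :
    ∃ T T' : Finset (Fin 18), T.card = 4 ∧ T'.card = 4 ∧
      {c : Fin 18 → F4 | extQR4Mem α c ∧ wt c = 13 ∧ T ⊆ supp c}.ncard ≠
        {c : Fin 18 → F4 | extQR4Mem α c ∧ wt c = 13 ∧ T' ⊆ supp c}.ncard := by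
  obtain ⟨S, hS, hmem⟩ := exists_extQR4Mem_iff hα
  simp only [hmem]
  by_contra! h
  have heq := ncard_disjoint_supp_eq h (T := bitPositions 15) (T' := bitPositions 23)
    (by decide) (by decide)
  rcases hS with rfl | rfl
  · rw [isRedundancy_squaresRedundancy.ncard_eq_avoidingCount (by norm_num),
      isRedundancy_squaresRedundancy.ncard_eq_avoidingCount (by norm_num)] at heq
    exact avoidingCount_squaresRedundancy_ne heq
  · rw [isRedundancy_nonsquaresRedundancy.ncard_eq_avoidingCount (by norm_num),
      isRedundancy_nonsquaresRedundancy.ncard_eq_avoidingCount (by norm_num)] at heq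
    exact avoidingCount_nonsquaresRedundancy_ne heq
end
end
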